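/- arXiv:1705.02362 — 2 statements merged into one kernel-verified Lean document; each statement's English description precedes it below -/
import Mathlib

section
/- Assume hypotheses (A1), (A2) and (A3), and let ρ be the unique positive zero of F̄(r) = ∫_{−1}^{1} √(1 − s²) f(r s) ds. Then for every ε > 0 there exists λ₀ > 0 such that for every λ ∈ (0, λ₀) the Liénard system (S1) has a nonconstant periodic solution whose image Φ₀(λ) ⊂ ℝ² satisfies d_H(Φ₀(λ), S_ρ) < ε, where S_ρ = {(x, y) ∈ ℝ² : x² + y² = ρ²}. -/
/-- A nonconstant periodic solution of the Liénard system
`x' = y, y' = -x - λ f(x) y`. -/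
def IsPeriodicSol (f : ℝ → ℝ) (lam : ℝ) (x y : ℝ → ℝ) : Prop :=
  (∃ T : ℝ, 0 < T ∧ ∀ t, x (t + T) = x t ∧ y (t + T) = y t) ∧
  (∀ t, HasDerivAt x (y t) t) ∧
  (∀ t, HasDerivAt y (-(x t) - lam * f (x t) * y t) t) ∧
  (∃ t₁ t₂, (x t₁, y t₁) ≠ (x t₂, y t₂))

section Averaging

open Set Metric Real
open scoped NNReal

/-- First-order averaging for the scalar equation `α' = l G(l, α, θ)`: if the average of
`G(0, r, ·)` changes from positive to negative near `r = ρ`, then for small `l` the equation has a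
solution near `ρ` with `α T = α 0`. -/
theorem exists_periodic_of_average_sign {G : ℝ × ℝ × ℝ → ℝ} {K : ℝ≥0} {T ρ δ C : ℝ}
    (hT : 0 < T) (hδ : 0 < δ) (hG : LipschitzWith K G) (hC : 0 < C) (hGC : ∀ p, |G p| ≤ C)
    (hlo : 0 < ∫ θ in (0:ℝ)..T, G (0, ρ - δ, θ))
    (hhi : ∫ θ in (0:ℝ)..T, G (0, ρ + δ, θ) < 0) :
    ∃ l₀ > (0:ℝ), ∀ l, 0 < l → l < l₀ → ∃ α : ℝ → ℝ, α T = α 0 ∧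
      ∀ θ ∈ Icc 0 T, |α θ - ρ| ≤ 2 * δ ∧
        HasDerivWithinAt α (l * G (l, α θ, θ)) (Icc 0 T) θ := by
  obtain ⟨m, hm, hm1, hm2⟩ : ∃ m > (0:ℝ), m ≤ ∫ θ in (0:ℝ)..T, G (0, ρ - δ, θ) ∧
      ∫ θ in (0:ℝ)..T, G (0, ρ + δ, θ) ≤ -m := by
    refine ⟨min (∫ θ in (0:ℝ)..T, G (0, ρ - δ, θ)) (-∫ θ in (0:ℝ)..T, G (0, ρ + δ, θ)),
      lt_min hlo (by linarith), min_le_left _ _, ?_⟩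
    linarith [min_le_right (∫ θ in (0:ℝ)..T, G (0, ρ - δ, θ))
      (-∫ θ in (0:ℝ)..T, G (0, ρ + δ, θ))]
  have hB : 0 < (K + 1) * (1 + C * T) * T := by positivity
  refine ⟨min (δ / (C * T)) (m / ((K + 1) * (1 + C * T) * T)), by positivity, fun l hl hl0 ↦ ?_⟩
  have hl1 : l * (C * T) < δ := (lt_div_iff₀ (by positivity)).1 (hl0.trans_le (min_le_left _ _))
  have hl2 : l * ((K + 1) * (1 + C * T) * T) < m :=
    (lt_div_iff₀ hB).1 (hl0.trans_le (min_le_right _ _))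
  have hGc := hG.continuous
  have pl : IsPicardLindelof (fun θ r ↦ l * G (l, r, θ)) (tmin := 0) (tmax := T)
      ⟨0, le_rfl, hT.le⟩ ρ (2 * δ).toNNReal δ.toNNReal (l * C).toNNReal (l.toNNReal * K) := by
    refine ⟨fun t _ ↦ LipschitzWith.lipschitzOnWith ?_, fun x _ ↦ ?_, fun t _ x _ ↦ ?_, ?_⟩
    · refine LipschitzWith.of_dist_le_mul fun x y ↦ ?_
      have := hG.dist_le_mul (l, x, t) (l, y, t)
      simp only [Prod.dist_eq, dist_self] at this
      rw [max_eq_right (by positivity), max_eq_left (by positivity)] at this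
      rw [Real.dist_eq] at this ⊢
      rw [← mul_sub, abs_mul, abs_of_pos hl, NNReal.coe_mul, Real.coe_toNNReal _ hl.le, mul_assoc]
      gcongr
    · fun_prop
    · rw [Real.coe_toNNReal _ (by positivity), norm_mul, norm_of_nonneg hl.le]
      have := hGC (l, x, t)
      simp only [Real.norm_eq_abs]
      gcongr
    · rw [Real.coe_toNNReal _ (by positivity), Real.coe_toNNReal _ (by positivity),
        Real.coe_toNNReal _ (by positivity)]
      simp only [sub_zero, sub_self, max_eq_left hT.le]
      nlinarith
  obtain ⟨α, hα, L', hL'⟩ := pl.exists_forall_mem_closedBall_eq_hasDerivWithinAt_lipschitzOnWith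
  rw [Real.coe_toNNReal _ hδ.le] at hα hL'
  have hclose : ∀ x ∈ closedBall ρ δ, ∀ θ ∈ Icc 0 T, |α x θ - x| ≤ l * (C * T) := by
    intro x hx θ hθ
    have := norm_image_sub_le_of_norm_deriv_le_segment' (C := l * C) (hα x hx).2
      (fun t _ ↦ by
        rw [norm_mul, norm_of_nonneg hl.le]
        have := hGC (l, α x t, t)
        simp only [Real.norm_eq_abs]
        gcongr) θ hθ
    have h0 : α x 0 = x := (hα x hx).1
    rw [h0, Real.norm_eq_abs, sub_zero] at this
    have h2 : l * C * θ ≤ l * C * T := by gcongr; exact hθ.2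
    linarith
  have haver : ∀ x ∈ closedBall ρ δ,
      |α x T - x - l * ∫ θ in (0:ℝ)..T, G (0, x, θ)| < l * m := by
    intro x hx
    have hd : ∀ θ ∈ Icc 0 T, HasDerivWithinAt (fun θ ↦ α x θ - l * ∫ φ in (0:ℝ)..θ, G (0, x, φ))
        (l * G (l, α x θ, θ) - l * G (0, x, θ)) (Icc 0 T) θ := by
      intro θ hθ
      refine ((hα x hx).2 θ hθ).sub (HasDerivAt.hasDerivWithinAt (HasDerivAt.const_mul _ ?_))
      exact ((by fun_prop : Continuous fun φ ↦ G (0, x, φ)).integral_hasStrictDerivAt 0 θ).hasDerivAt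
    have := norm_image_sub_le_of_norm_deriv_le_segment' (C := l * (K * (l * (1 + C * T)))) hd
      (fun t ht ↦ by
        rw [← mul_sub, norm_mul, norm_of_nonneg hl.le, ← dist_eq_norm]
        gcongr
        refine (hG.dist_le_mul _ _).trans ?_
        gcongr
        have h3 := hclose x hx t ⟨ht.1, ht.2.le⟩
        have : 0 < C * T := by positivity
        simp only [Prod.dist_eq, dist_self, Real.dist_eq, sub_zero, abs_of_pos hl]
        refine max_le (by nlinarith) (max_le (by nlinarith) (by positivity))) T ⟨hT.le, le_rfl⟩
    have h0 : α x 0 = x := (hα x hx).1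
    simp only [h0, intervalIntegral.integral_same, mul_zero, sub_zero, Real.norm_eq_abs] at this
    rw [sub_right_comm]
    refine this.trans_lt ?_
    have h4 : l * (K * (l * (1 + C * T))) * T ≤ l * (l * ((K + 1) * (1 + C * T) * T)) := by
      have : 0 ≤ l * (l * ((1 + C * T) * T)) := by positivity
      nlinarith
    nlinarith
  have hcont : ContinuousOn (fun x ↦ α x T - x) (Icc (ρ - δ) (ρ + δ)) := by
    rw [← Real.closedBall_eq_Icc]
    exact (hL' T ⟨hT.le, le_rfl⟩).continuousOn.sub continuousOn_id
  have hmem1 : ρ - δ ∈ closedBall ρ δ := by simp [abs_of_pos hδ]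
  have hmem2 : ρ + δ ∈ closedBall ρ δ := by simp [abs_of_pos hδ]
  have h1 := abs_lt.1 (haver _ hmem1)
  have h2 := abs_lt.1 (haver _ hmem2)
  obtain ⟨x, hx, hx0⟩ := intermediate_value_Icc' (by linarith) hcont
    (show (0:ℝ) ∈ Icc _ _ from ⟨by nlinarith, by nlinarith⟩)
  rw [← Real.closedBall_eq_Icc] at hx
  refine ⟨α x, ?_, fun θ hθ ↦ ⟨?_, (hα x hx).2 θ hθ⟩⟩
  · have h0 : α x 0 = x := (hα x hx).1
    rw [h0]
    linarith
  · have h3 := hclose x hx θ hθ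
    rw [mem_closedBall, Real.dist_eq] at hx
    calc |α x θ - ρ| ≤ |α x θ - x| + |x - ρ| := abs_sub_le _ _ _
      _ ≤ 2 * δ := by linarith

theorem exists_periodic_of_average_sign_of_lipschitzOnWith
    {G : ℝ × ℝ × ℝ → ℝ} {K : ℝ≥0} {l₁ T ρ δ : ℝ}
    (hl₁ : 0 < l₁) (hT : 0 < T) (hδ : 0 < δ)
    (hG : LipschitzOnWith K G (Icc 0 l₁ ×ˢ Icc (ρ - 2 * δ) (ρ + 2 * δ) ×ˢ Icc 0 T))
    (hlo : 0 < ∫ θ in (0:ℝ)..T, G (0, ρ - δ, θ))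
    (hhi : ∫ θ in (0:ℝ)..T, G (0, ρ + δ, θ) < 0) :
    ∃ l₀ > (0:ℝ), ∀ l, 0 < l → l < l₀ → ∃ α : ℝ → ℝ, α T = α 0 ∧
      ∀ θ ∈ Icc 0 T, |α θ - ρ| ≤ 2 * δ ∧
        HasDerivWithinAt α (l * G (l, α θ, θ)) (Icc 0 T) θ := by
  set S : Set (ℝ × ℝ × ℝ) := Icc 0 l₁ ×ˢ Icc (ρ - 2 * δ) (ρ + 2 * δ) ×ˢ Icc 0 T with hS
  have hSc : IsCompact S := isCompact_Icc.prod (isCompact_Icc.prod isCompact_Icc)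
  obtain ⟨C₀, hC₀⟩ := hSc.exists_bound_of_continuousOn hG.continuousOn
  obtain ⟨g, hgL, hgG⟩ := hG.extend_real
  set C := |C₀| + 1 with hC
  have hCpos : 0 < C := by positivity
  set H : ℝ × ℝ × ℝ → ℝ := fun p ↦ max (-C) (min C (g p)) with hH
  have hHG : ∀ p ∈ S, H p = G p := by
    intro p hp
    have := abs_le.1 ((hC₀ p hp).trans (le_abs_self C₀))
    simp only [hH, ← hgG hp]
    rw [min_eq_right (by linarith), max_eq_right (by linarith)]
  have h_integral : ∀ x ∈ Icc (ρ - 2 * δ) (ρ + 2 * δ),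
      ∫ θ in (0:ℝ)..T, H (0, x, θ) = ∫ θ in (0:ℝ)..T, G (0, x, θ) := by
    intro x hx
    refine intervalIntegral.integral_congr fun θ hθ ↦ hHG _ ⟨⟨le_rfl, hl₁.le⟩, hx, ?_⟩
    rwa [uIcc_of_le hT.le] at hθ
  obtain ⟨l₀, hl₀, h⟩ := exists_periodic_of_average_sign (ρ := ρ) hT hδ
    ((hgL.const_min C).const_max (-C)) hCpos
    (fun p ↦ abs_le.2 ⟨le_max_left _ _, max_le (by linarith) (min_le_left _ _)⟩)
    (by rw [h_integral _ ⟨by linarith, by linarith⟩]; exact hlo)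
    (by rw [h_integral _ ⟨by linarith, by linarith⟩]; exact hhi)
  refine ⟨min l₀ l₁, lt_min hl₀ hl₁, fun l hl hll ↦ ?_⟩
  obtain ⟨α, hα, hα'⟩ := h l hl (hll.trans_le (min_le_left _ _))
  refine ⟨α, hα, fun θ hθ ↦ ⟨(hα' θ hθ).1, ?_⟩⟩
  have h1 := abs_le.1 (hα' θ hθ).1
  rw [← hHG (l, α θ, θ) ⟨⟨hl.le, (hll.trans_le (min_le_right _ _)).le⟩,
    ⟨by linarith, by linarith⟩, hθ⟩]
  exact (hα' θ hθ).2

theorem exists_periodic_extension {α : ℝ → ℝ} {v : ℝ → ℝ → ℝ} {T : ℝ} (hT : 0 < T)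
    (hv : ∀ r, Function.Periodic (v r) T) (hα : α T = α 0)
    (hd : ∀ θ ∈ Icc 0 T, HasDerivWithinAt α (v (α θ) θ) (Icc 0 T) θ) :
    ∃ R : ℝ → ℝ, Function.Periodic R T ∧ (∀ θ, HasDerivAt R (v (R θ) θ) θ) ∧
      ∀ θ, ∃ φ ∈ Icc 0 T, R θ = α φ := by
  set R : ℝ → ℝ := fun θ ↦ α (toIcoMod hT 0 θ) with hR
  have hper : Function.Periodic R T := fun θ ↦ by simp [hR]
  have hmem : ∀ θ, toIcoMod hT 0 θ ∈ Ico 0 T := fun θ ↦ by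
    simpa using toIcoMod_mem_Ico hT 0 θ
  have hRα : EqOn R α (Icc 0 T) := by
    intro θ hθ
    rcases hθ.2.lt_or_eq with h | rfl
    · simp only [hR]
      rw [(toIcoMod_eq_self hT).2 ⟨hθ.1, by simpa using h⟩]
    · have : toIcoMod hT 0 θ = 0 := by simpa using toIcoMod_apply_right hT 0
      simp only [hR]
      rw [this, hα]
  have hdR : ∀ θ ∈ Icc 0 T, HasDerivWithinAt R (v (R θ) θ) (Icc 0 T) θ := fun θ hθ ↦ by
    rw [hRα hθ]
    exact (hd θ hθ).congr hRα (hRα hθ)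
  have hbase : ∀ θ ∈ Ico 0 T, HasDerivAt R (v (R θ) θ) θ := by
    intro θ hθ
    rcases hθ.1.eq_or_lt with rfl | h
    · have hr : HasDerivWithinAt R (v (R 0) 0) (Ici 0) 0 :=
        (hdR 0 ⟨le_rfl, hT.le⟩).mono_of_mem_nhdsWithin (Icc_mem_nhdsGE hT)
      have hl : HasDerivWithinAt R (v (R 0) 0) (Iic 0) 0 := by
        have h1 : HasDerivWithinAt R (v (R T) T) (Iic T) T :=
          (hdR T ⟨hT.le, le_rfl⟩).mono_of_mem_nhdsWithin (Icc_mem_nhdsLE hT)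
        have h2 : v (R T) T = v (R 0) 0 := by
          have := hper 0
          have h3 := hv (R 0) 0
          rw [zero_add] at this h3
          rw [this, h3]
        rw [h2] at h1
        have h3 : HasDerivWithinAt (fun x ↦ R (x + T)) (v (R 0) 0 * 1) (Iic 0) 0 := by
          refine HasDerivWithinAt.comp (h₂ := R) (h := fun x ↦ x + T) (s' := Iic T) 0 ?_ ?_ ?_
          · simpa using h1
          · exact ((hasDerivAt_id (0:ℝ)).add_const T).hasDerivWithinAt
          · intro x hx
            simpa using hx
        simpa only [mul_one, hper _] using h3
      have := hl.union hr
      rwa [Iic_union_Ici, hasDerivWithinAt_univ] at this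
    · exact (hdR θ ⟨hθ.1, hθ.2.le⟩).hasDerivAt (Icc_mem_nhds h hθ.2)
  refine ⟨R, hper, fun θ ↦ ?_, fun θ ↦ ⟨_, Ico_subset_Icc_self (hmem θ), rfl⟩⟩
  set n := toIcoDiv hT 0 θ with hn
  have hθ : toIcoMod hT 0 θ = θ - n • T := rfl
  have h1 := hbase _ (hmem θ)
  rw [hθ, (hper.sub_zsmul_eq n), (hv _).sub_zsmul_eq n] at h1
  have h2 : HasDerivAt (fun x ↦ R (x - n • T)) (v (R θ) θ) θ := h1.comp_sub_const θ (n • T)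
  simpa only [hper.sub_zsmul_eq n] using h2

/-- The autonomous scalar equation `Θ' = Ω(Θ)` with positive periodic right-hand side has a
solution that runs through one period of `Ω` in a fixed time. -/
theorem exists_time_change {Ω : ℝ → ℝ} {T : ℝ} (hc : Continuous Ω) (hT : 0 < T)
    (hper : Function.Periodic Ω T) (hlo : ∀ θ, 0 < Ω θ) (hhi : ∀ θ, Ω θ ≤ 2) :
    ∃ Θ : ℝ → ℝ, ∃ τ > (0:ℝ), Function.Surjective Θ ∧ (∀ t, Θ (t + τ) = Θ t + T) ∧
      ∀ t, HasDerivAt Θ (Ω (Θ t)) t := by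
  have hc' : Continuous fun θ ↦ (Ω θ)⁻¹ := hc.inv₀ fun θ ↦ (hlo θ).ne'
  set σ : ℝ → ℝ := fun θ ↦ ∫ φ in (0:ℝ)..θ, (Ω φ)⁻¹ with hσ
  have hdσ : ∀ θ, HasDerivAt σ (Ω θ)⁻¹ θ := fun θ ↦ (hc'.integral_hasStrictDerivAt 0 θ).hasDerivAt
  have hσ0 : σ 0 = 0 := by simp [hσ]
  have hmono : StrictMono σ := strictMono_of_deriv_pos fun θ ↦ by
    rw [(hdσ θ).deriv]
    exact inv_pos.2 (hlo θ)
  have hmono2 : Monotone fun θ ↦ σ θ - θ / 2 := by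
    have hd : ∀ θ, HasDerivAt (fun θ ↦ σ θ - θ / 2) ((Ω θ)⁻¹ - 1 / 2) θ := fun θ ↦
      (hdσ θ).sub ((hasDerivAt_id θ).div_const 2)
    refine monotone_of_deriv_nonneg (fun θ ↦ (hd θ).differentiableAt) fun θ ↦ ?_
    rw [(hd θ).deriv, sub_nonneg, one_div]
    exact inv_anti₀ (hlo θ) (hhi θ)
  have hσc : Continuous σ := continuous_iff_continuousAt.2 fun θ ↦ (hdσ θ).continuousAt
  have hsurj : Function.Surjective σ := by
    refine hσc.surjective ?_ ?_
    · refine Filter.tendsto_atTop_mono' _ ?_ (Filter.tendsto_id.atTop_div_const (two_pos (α := ℝ)))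
      filter_upwards [Filter.eventually_ge_atTop 0] with θ hθ
      have := hmono2 hθ
      simp only [hσ0] at this
      simp only [id]
      linarith
    · refine Filter.tendsto_atBot_mono' _ ?_ (Filter.tendsto_id.atBot_div_const (two_pos (α := ℝ)))
      filter_upwards [Filter.eventually_le_atBot 0] with θ hθ
      have := hmono2 hθ
      simp only [hσ0] at this
      simp only [id]
      linarith
  have hσper : ∀ θ, σ (θ + T) = σ θ + σ T := by
    intro θ
    have h1 : Function.Periodic (fun θ ↦ (Ω θ)⁻¹) T := fun θ ↦ by simp only [hper θ]
    have h2 := h1.intervalIntegral_add_eq θ 0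
    have h3 := intervalIntegral.integral_add_adjacent_intervals
      (hc'.intervalIntegrable (μ := MeasureTheory.volume) 0 θ) (hc'.intervalIntegrable θ (θ + T))
    rw [zero_add] at h2
    simp only [hσ]
    rw [← h3, h2]
  set e := hmono.orderIsoOfSurjective σ hsurj with he
  have hes : ∀ t, σ (e.symm t) = t := fun t ↦ e.apply_symm_apply t
  refine ⟨e.symm, σ T, by rw [← hσ0]; exact hmono hT, e.symm.surjective, fun t ↦ ?_, fun t ↦ ?_⟩
  · apply hmono.injective
    rw [hes, hσper, hes]
  · have := HasDerivAt.of_local_left_inverse (g := e.symm) (a := t) e.symm.continuous.continuousAt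
      (hdσ _) (inv_ne_zero (hlo _).ne') (Filter.Eventually.of_forall hes)
    rwa [inv_inv] at this

theorem integral_comp_cos_mul_sin_sq {f : ℝ → ℝ} (hf : Continuous f) (r : ℝ) :
    ∫ θ in (0:ℝ)..(2 * π), f (r * cos θ) * sin θ ^ 2 =
      2 * ∫ s in (-1:ℝ)..1, √(1 - s ^ 2) * f (r * s) := by
  have hg : Continuous fun s : ℝ ↦ √(1 - s ^ 2) * f (r * s) := by fun_prop
  have hsub : ∀ a b : ℝ, ∫ θ in a..b, (√(1 - cos θ ^ 2) * f (r * cos θ)) * (-sin θ) =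
      ∫ s in cos a..cos b, √(1 - s ^ 2) * f (r * s) := fun a b ↦
    intervalIntegral.integral_comp_mul_deriv (f := cos) (f' := fun θ ↦ -sin θ)
      (fun θ _ ↦ hasDerivAt_cos θ) (by fun_prop) hg
  have h_integral : ∀ a b : ℝ, IntervalIntegrable (fun θ ↦ f (r * cos θ) * sin θ ^ 2)
      MeasureTheory.volume a b := fun a b ↦ Continuous.intervalIntegrable (by fun_prop) a b
  have h1 : ∫ θ in (0:ℝ)..π, f (r * cos θ) * sin θ ^ 2 =
      ∫ s in (-1:ℝ)..1, √(1 - s ^ 2) * f (r * s) := by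
    have := hsub 0 π
    rw [cos_zero, cos_pi, intervalIntegral.integral_symm (-1) 1] at this
    rw [← neg_eq_iff_eq_neg.2 this, ← intervalIntegral.integral_neg]
    refine intervalIntegral.integral_congr fun θ hθ ↦ ?_
    rw [uIcc_of_le pi_pos.le] at hθ
    have hs := sin_nonneg_of_nonneg_of_le_pi hθ.1 hθ.2
    simp only [← sin_sq, sqrt_sq hs]
    ring
  have h2 : ∫ θ in π..(2 * π), f (r * cos θ) * sin θ ^ 2 =
      ∫ s in (-1:ℝ)..1, √(1 - s ^ 2) * f (r * s) := by
    have := hsub π (2 * π)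
    rw [cos_two_pi, cos_pi] at this
    rw [← this]
    refine intervalIntegral.integral_congr fun θ hθ ↦ ?_
    rw [uIcc_of_le (by linarith [pi_pos])] at hθ
    have hs : sin θ ≤ 0 := by
      rw [← sin_sub_two_pi]
      exact sin_nonpos_of_nonpos_of_neg_pi_le (by linarith [hθ.2]) (by linarith [hθ.1])
    simp only [← sin_sq, sqrt_sq_eq_abs, abs_of_nonpos hs]
    ring
  rw [← intervalIntegral.integral_add_adjacent_intervals (h_integral 0 π) (h_integral π (2 * π)), h1, h2]
  ring

theorem pos_of_forall_ne_zero {f : ℝ → ℝ} (hf : Continuous f) {S : Set ℝ} [hS : S.OrdConnected]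
    (h0 : ∀ x ∈ S, f x ≠ 0) {x y : ℝ} (hx : x ∈ S) (hfx : 0 < f x) (hy : y ∈ S) : 0 < f y := by
  by_contra! h
  obtain ⟨z, hz, hz0⟩ := intermediate_value_uIcc (hf.continuousOn (s := uIcc y x))
    (show (0:ℝ) ∈ uIcc (f y) (f x) from Icc_subset_uIcc ⟨h, hfx.le⟩)
  exact h0 z (hS.uIcc_subset hy hx hz) hz0

theorem exists_neg_and_exists_pos_of_deriv_pos {f : ℝ → ℝ} {c a b : ℝ} (hc : f c = 0)
    (hd : 0 < deriv f c) (ha : a < c) (hb : c < b) :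
    (∃ x ∈ Ioo a c, f x < 0) ∧ ∃ x ∈ Ioo c b, 0 < f x := by
  have hd' : HasDerivAt f (deriv f c) c :=
    (differentiableAt_of_deriv_ne_zero hd.ne').hasDerivAt
  have h := (hasDerivAt_iff_tendsto_slope.1 hd').eventually_const_lt hd
  constructor
  · have h1 := h.filter_mono (nhdsWithin_mono c fun x (hx : x ∈ Iio c) ↦ ne_of_lt hx)
    obtain ⟨x, hx, hxm⟩ := (h1.and (Ioo_mem_nhdsLT ha)).exists
    refine ⟨x, hxm, ?_⟩
    rw [slope_def_field, hc, sub_zero] at hx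
    by_contra! h2
    exact absurd hx (not_lt.2 (div_nonpos_of_nonneg_of_nonpos h2 (by linarith [hxm.2])))
  · have h1 := h.filter_mono (nhdsWithin_mono c fun x (hx : x ∈ Ioi c) ↦ ne_of_gt hx)
    obtain ⟨x, hx, hxm⟩ := (h1.and (Ioo_mem_nhdsGT hb)).exists
    refine ⟨x, hxm, ?_⟩
    rw [slope_def_field, hc, sub_zero] at hx
    by_contra! h2
    exact absurd hx (not_lt.2 (div_nonpos_of_nonpos_of_nonneg h2 (by linarith [hxm.1])))

theorem sign_of_two_zeros {f : ℝ → ℝ} {a b : ℝ} (hf : Continuous f) (hab : a < b)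
    (hfa : f a = 0) (hfb : f b = 0) (hzeros : ∀ x, f x = 0 → x = a ∨ x = b)
    (hda : deriv f a < 0) (hdb : 0 < deriv f b) :
    (∀ x < a, 0 < f x) ∧ (∀ x ∈ Ioo a b, f x < 0) ∧ ∀ x > b, 0 < f x := by
  obtain ⟨⟨p, hp, hfp⟩, q, hq, hfq⟩ := exists_neg_and_exists_pos_of_deriv_pos hfb hdb hab
    (lt_add_one b)
  obtain ⟨⟨s, hs, hfs⟩, -⟩ := exists_neg_and_exists_pos_of_deriv_pos (f := -f) (c := a)
    (by simp [hfa]) (by rw [deriv.neg]; linarith) (sub_one_lt a) hab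
  have hfs' : 0 < f s := by simpa using hfs
  refine ⟨fun x hx ↦ ?_, fun x hx ↦ ?_, fun x hx ↦ ?_⟩
  · refine pos_of_forall_ne_zero hf (S := Iio a) (fun y hy hy0 ↦ ?_) hs.2 hfs' hx
    have hy : y < a := hy
    rcases hzeros y hy0 with h | h <;> linarith
  · have := pos_of_forall_ne_zero hf.neg (S := Ioo a b) (fun y hy hy0 ↦ ?_) hp (neg_pos.2 hfp) hx
    · exact neg_pos.1 this
    · rcases hzeros y (neg_eq_zero.1 hy0) with h | h <;> linarith [hy.1, hy.2]
  · refine pos_of_forall_ne_zero hf (S := Ioi b) (fun y hy hy0 ↦ ?_) hq.1 hfq hx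
    have hy : b < y := hy
    rcases hzeros y hy0 with h | h <;> linarith

theorem integral_sqrt_mul_pos_of_large {f : ℝ → ℝ} {a b x₁ x₂ r : ℝ} (hf : Continuous f)
    (hab : a < b) (hx₁ : x₁ < a) (hx₂ : b < x₂)
    (hneg : ∀ x ∈ Ioo a b, f x < 0) (hl : ∀ x ≤ a, 0 ≤ f x) (hr : ∀ x ≥ b, 0 ≤ f x)
    (h₁ : ∫ s in x₁..b, f s = 0) (h₂ : ∫ s in a..x₂, f s = 0)
    (hr0 : 0 < r) (hr₁ : -(r / 2) ≤ x₁) (hr₂ : x₂ ≤ r / 2) :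
    0 < ∫ s in (-1:ℝ)..1, √(1 - s ^ 2) * f (r * s) := by
  set w : ℝ → ℝ := fun u ↦ √(1 - (u / r) ^ 2) * f u with hw
  have hwc : Continuous w := by fun_prop
  have hi : ∀ {g : ℝ → ℝ}, Continuous g → ∀ p q : ℝ,
    IntervalIntegrable g MeasureTheory.volume p q := fun h p q ↦ h.intervalIntegrable p q
  have hscale : ∫ s in (-1:ℝ)..1, √(1 - s ^ 2) * f (r * s) = r⁻¹ * ∫ u in -r..r, w u := by
    have := intervalIntegral.integral_comp_mul_left (a := -1) (b := 1) w hr0.ne'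
    rw [mul_one, mul_neg_one, smul_eq_mul] at this
    rw [← this]
    refine intervalIntegral.integral_congr fun s _ ↦ ?_
    simp only [hw, mul_div_cancel_left₀ _ hr0.ne']
  have hweight : ∀ u ∈ Icc x₁ x₂, 3 / 4 ≤ √(1 - (u / r) ^ 2) := by
    intro u hu
    apply le_sqrt_of_sq_le
    have h1 : |u / r| ≤ 1 / 2 := by
      rw [abs_div, abs_of_pos hr0, div_le_iff₀ hr0]
      exact abs_le.2 ⟨by linarith [hu.1], by linarith [hu.2]⟩
    have := sq_le_sq' (by linarith [(abs_le.1 h1).1]) (abs_le.1 h1).2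
    linarith
  have hweight' : ∀ u, √(1 - (u / r) ^ 2) ≤ 1 := fun u ↦ by
    rw [sqrt_le_one]
    linarith [sq_nonneg (u / r)]
  have i₁ : 0 ≤ ∫ u in -r..x₁, w u := intervalIntegral.integral_nonneg (by linarith) fun u hu ↦
    mul_nonneg (sqrt_nonneg _) (hl u (by linarith [hu.2]))
  have i₅ : 0 ≤ ∫ u in x₂..r, w u := intervalIntegral.integral_nonneg (by linarith) fun u hu ↦
    mul_nonneg (sqrt_nonneg _) (hr u (by linarith [hu.1]))
  have i₂ : ∫ u in x₁..a, 3 / 4 * f u ≤ ∫ u in x₁..a, w u :=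
    intervalIntegral.integral_mono_on hx₁.le (hi (by fun_prop) _ _) (hi hwc _ _) fun u hu ↦
      mul_le_mul_of_nonneg_right (hweight u ⟨hu.1, by linarith [hu.2]⟩) (hl u hu.2)
  have i₄ : ∫ u in b..x₂, 3 / 4 * f u ≤ ∫ u in b..x₂, w u :=
    intervalIntegral.integral_mono_on hx₂.le (hi (by fun_prop) _ _) (hi hwc _ _) fun u hu ↦
      mul_le_mul_of_nonneg_right (hweight u ⟨by linarith [hu.1], hu.2⟩) (hr u hu.1)
  have i₃ : ∫ u in a..b, f u ≤ ∫ u in a..b, w u :=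
    intervalIntegral.integral_mono_on_of_le_Ioo hab.le (hi hf _ _) (hi hwc _ _) fun u hu ↦ by
      have := mul_le_mul_of_nonpos_right (hweight' u) (hneg u hu).le
      simpa [hw] using this
  have hI : 0 < ∫ u in a..b, -f u :=
    intervalIntegral.intervalIntegral_pos_of_pos_on (hi hf.neg _ _)
      (fun u hu ↦ neg_pos.2 (hneg u hu)) hab
  rw [intervalIntegral.integral_const_mul] at i₂ i₄
  rw [intervalIntegral.integral_neg] at hI
  have e₁ := intervalIntegral.integral_add_adjacent_intervals (hi hf x₁ a) (hi hf a b)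
  have e₂ := intervalIntegral.integral_add_adjacent_intervals (hi hf a b) (hi hf b x₂)
  have e₃ := intervalIntegral.integral_add_adjacent_intervals (hi hwc (-r) x₁) (hi hwc x₁ a)
  have e₄ := intervalIntegral.integral_add_adjacent_intervals (hi hwc (-r) a) (hi hwc a b)
  have e₅ := intervalIntegral.integral_add_adjacent_intervals (hi hwc (-r) b) (hi hwc b x₂)
  have e₆ := intervalIntegral.integral_add_adjacent_intervals (hi hwc (-r) x₂) (hi hwc x₂ r)
  rw [hscale]
  exact mul_pos (inv_pos.2 hr0) (by linarith)

theorem integral_sqrt_mul_neg_of_small {f : ℝ → ℝ} {a b r : ℝ} (hf : Continuous f)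
    (hneg : ∀ x ∈ Ioo a b, f x < 0) (hr0 : 0 < r) (hra : a ≤ -r) (hrb : r ≤ b) :
    ∫ s in (-1:ℝ)..1, √(1 - s ^ 2) * f (r * s) < 0 := by
  have h : 0 < ∫ s in (-1:ℝ)..1, -(√(1 - s ^ 2) * f (r * s)) := by
    refine intervalIntegral.intervalIntegral_pos_of_pos_on
      (Continuous.intervalIntegrable (by fun_prop) _ _) (fun s hs ↦ ?_) (by norm_num)
    have h1 : 0 < √(1 - s ^ 2) := sqrt_pos.2 (by nlinarith [hs.1, hs.2])
    have h2 : f (r * s) < 0 := hneg _ ⟨by nlinarith [hs.1], by nlinarith [hs.2]⟩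
    exact neg_pos.2 (mul_neg_of_pos_of_neg h1 h2)
  rw [intervalIntegral.integral_neg] at h
  linarith

theorem sign_of_unique_zero {g : ℝ → ℝ} {ρ p q : ℝ} (hg : Continuous g)
    (huniq : ∀ r, 0 < r → g r = 0 → r = ρ) (hp : 0 < p) (hpρ : p < ρ) (hgp : g p < 0)
    (hq : ρ < q) (hgq : 0 < g q) :
    (∀ r, 0 < r → r < ρ → g r < 0) ∧ ∀ r, ρ < r → 0 < g r := by
  refine ⟨fun r hr hrρ ↦ ?_, fun r hr ↦ ?_⟩
  · refine neg_pos.1 (pos_of_forall_ne_zero hg.neg (S := Ioo 0 ρ) (fun y hy hy0 ↦ ?_)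
      ⟨hp, hpρ⟩ (neg_pos.2 hgp) ⟨hr, hrρ⟩)
    exact hy.2.ne (huniq y hy.1 (neg_eq_zero.1 hy0))
  · refine pos_of_forall_ne_zero hg (S := Ioi ρ) (fun y hy hy0 ↦ ?_) hq hgq hr
    have hy : ρ < y := hy
    exact hy.ne' (huniq y (by linarith) hy0)

theorem exists_isPeriodicSol_of_polar {f R : ℝ → ℝ} {l : ℝ} (hf : Continuous f)
    (hper : Function.Periodic R (2 * π)) (hpos : ∀ θ, 0 < R θ)
    (hsmall : ∀ θ, |l * f (R θ * cos θ) * sin θ * cos θ| ≤ 1 / 2)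
    (hR : ∀ θ, HasDerivAt R (l * (-(f (R θ * cos θ) * R θ * sin θ ^ 2) /
      (1 - l * f (R θ * cos θ) * sin θ * cos θ))) θ) :
    ∃ x y : ℝ → ℝ, IsPeriodicSol f l x y ∧
      range (fun t ↦ (x t, y t)) = range fun θ ↦ (R θ * cos θ, R θ * -sin θ) := by
  have hRc : Continuous R := continuous_iff_continuousAt.2 fun θ ↦ (hR θ).continuousAt
  have hb := fun θ ↦ abs_le.1 (hsmall θ)
  obtain ⟨Θ, τ, hτ, hsurj, hΘper, hΘ⟩ := exists_time_change
    (Ω := fun θ ↦ 1 - l * f (R θ * cos θ) * sin θ * cos θ) (T := 2 * π) (by fun_prop)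
    two_pi_pos (fun θ ↦ by simp only [hper θ, cos_add_two_pi, sin_add_two_pi])
    (fun θ ↦ by linarith [(hb θ).2]) (fun θ ↦ by linarith [(hb θ).1])
  have hne : ∀ θ, 1 - l * f (R θ * cos θ) * sin θ * cos θ ≠ 0 := fun θ ↦ by
    have h : 0 < 1 - l * f (R θ * cos θ) * sin θ * cos θ := by linarith [(hb θ).2]
    exact h.ne'
  have hRΘ := fun t ↦ (hR (Θ t)).comp t (hΘ t)
  refine ⟨fun t ↦ R (Θ t) * cos (Θ t), fun t ↦ R (Θ t) * -sin (Θ t),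
    ⟨⟨τ, hτ, fun t ↦ ?_⟩, fun t ↦ ?_, fun t ↦ ?_, ?_⟩, ?_⟩
  · simp only [hΘper, hper (Θ t), cos_add_two_pi, sin_add_two_pi, and_self]
  · refine ((hRΘ t).mul (hΘ t).cos).congr_deriv ?_
    rw [mul_assoc l, div_mul_cancel₀ _ (hne _)]
    simp only [Function.comp_apply]
    ring
  · refine ((hRΘ t).mul (hΘ t).sin.neg).congr_deriv ?_
    rw [mul_assoc l, div_mul_cancel₀ _ (hne _)]
    simp only [Function.comp_apply, Pi.neg_apply]
    linear_combination (l * f (R (Θ t) * cos (Θ t)) * R (Θ t) * sin (Θ t)) *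
      sin_sq_add_cos_sq (Θ t)
  · obtain ⟨t₁, h₁⟩ := hsurj 0
    obtain ⟨t₂, h₂⟩ := hsurj π
    refine ⟨t₁, t₂, fun h ↦ ?_⟩
    have := congrArg Prod.fst h
    simp only [h₁, h₂, cos_zero, cos_pi] at this
    linarith [hpos 0, hpos π]
  · exact hsurj.range_comp (fun θ ↦ (R θ * cos θ, R θ * -sin θ))

theorem hausdorffDist_polar_le {R : ℝ → ℝ} {ρ d : ℝ} (hρ : 0 < ρ) (hR : ∀ θ, |R θ - ρ| ≤ d) :
    hausdorffDist (range fun θ ↦ (R θ * cos θ, R θ * -sin θ))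
      {p : ℝ × ℝ | p.1 ^ 2 + p.2 ^ 2 = ρ ^ 2} ≤ d := by
  have hdist : ∀ θ, dist (R θ * cos θ, R θ * -sin θ) (ρ * cos θ, ρ * -sin θ) ≤ d := by
    intro θ
    have h : ∀ c, |c| ≤ 1 → |R θ * c - ρ * c| ≤ d := fun c hc ↦ by
      rw [← sub_mul, abs_mul]
      exact (mul_le_of_le_one_right (abs_nonneg _) hc).trans (hR θ)
    simp only [Prod.dist_eq, Real.dist_eq]
    exact max_le (h _ (abs_cos_le_one θ)) (h _ (by simpa using abs_sin_le_one θ))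
  refine hausdorffDist_le_of_mem_dist ((abs_nonneg _).trans (hR 0)) ?_ ?_
  · rintro _ ⟨θ, rfl⟩
    refine ⟨(ρ * cos θ, ρ * -sin θ), ?_, hdist θ⟩
    simp only [mem_ofPred_eq]
    linear_combination ρ ^ 2 * sin_sq_add_cos_sq θ
  · rintro ⟨x, y⟩ hxy
    have hxy : x ^ 2 + y ^ 2 = ρ ^ 2 := hxy
    set z : ℂ := ⟨x, -y⟩ with hz
    have hnorm : ‖z‖ = ρ := by
      rw [Complex.norm_eq_sqrt_sq_add_sq, hz, neg_sq, hxy, sqrt_sq hρ.le]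
    refine ⟨_, ⟨z.arg, rfl⟩, ?_⟩
    have h1 : ρ * cos z.arg = x := by rw [← hnorm, Complex.norm_mul_cos_arg]
    have h2 : ρ * -sin z.arg = y := by
      rw [← hnorm, mul_neg, Complex.norm_mul_sin_arg, hz, neg_neg]
    have := hdist z.arg
    rwa [h1, h2, dist_comm] at this

theorem limit_cycle_of_averaged_sign_change {f : ℝ → ℝ} (hf : ContDiff ℝ 1 f) {ρ δ : ℝ}
    (hδ : 0 < δ) (hδρ : 2 * δ < ρ)
    (hlo : ∫ s in (-1:ℝ)..1, √(1 - s ^ 2) * f ((ρ - δ) * s) < 0)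
    (hhi : 0 < ∫ s in (-1:ℝ)..1, √(1 - s ^ 2) * f ((ρ + δ) * s)) :
    ∃ l₀ > (0:ℝ), ∀ l, 0 < l → l < l₀ → ∃ x y : ℝ → ℝ, IsPeriodicSol f l x y ∧
      hausdorffDist (range fun t ↦ (x t, y t)) {p : ℝ × ℝ | p.1 ^ 2 + p.2 ^ 2 = ρ ^ 2}
        ≤ 2 * δ := by
  obtain ⟨M, hM⟩ :=
    (isCompact_Icc (a := -(ρ + 2 * δ)) (b := ρ + 2 * δ)).exists_bound_of_continuousOn
    hf.continuous.continuousOn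
  set l₁ : ℝ := 1 / (2 * (|M| + 1)) with hl₁
  have hl₁pos : 0 < l₁ := by positivity
  have hsmall : ∀ l ∈ Icc 0 l₁, ∀ r ∈ Icc (ρ - 2 * δ) (ρ + 2 * δ), ∀ θ : ℝ,
      |l * f (r * cos θ) * sin θ * cos θ| ≤ 1 / 2 := by
    intro l hl r hr θ
    have hmem : r * cos θ ∈ Icc (-(ρ + 2 * δ)) (ρ + 2 * δ) := by
      rw [mem_Icc, ← abs_le, abs_mul, abs_of_pos (by linarith [hr.1] : 0 < r)]
      exact (mul_le_of_le_one_right (by linarith [hr.1]) (abs_cos_le_one θ)).trans hr.2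
    have h1 : |f (r * cos θ)| ≤ |M| + 1 := by
      have := hM _ hmem
      rw [Real.norm_eq_abs] at this
      linarith [le_abs_self M]
    calc |l * f (r * cos θ) * sin θ * cos θ|
        = l * |f (r * cos θ)| * |sin θ| * |cos θ| := by
          rw [abs_mul, abs_mul, abs_mul, abs_of_nonneg hl.1]
      _ ≤ l₁ * (|M| + 1) * 1 * 1 := by
          have := hl.1
          gcongr
          exacts [hl.2, abs_sin_le_one θ, abs_cos_le_one θ]
      _ = 1 / 2 := by rw [hl₁]; field_simp
  set G : ℝ × ℝ × ℝ → ℝ := fun p ↦ -(f (p.2.1 * cos p.2.2) * p.2.1 * sin p.2.2 ^ 2) /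
    (1 - p.1 * f (p.2.1 * cos p.2.2) * sin p.2.2 * cos p.2.2) with hG
  have hGd : ContDiffOn ℝ 1 G (Icc 0 l₁ ×ˢ Icc (ρ - 2 * δ) (ρ + 2 * δ) ×ˢ Icc 0 (2 * π)) := by
    refine ContDiffOn.div (ContDiff.contDiffOn (by fun_prop)) (ContDiff.contDiffOn (by fun_prop)) ?_
    rintro ⟨l, r, θ⟩ ⟨hl, hr, -⟩
    have := (abs_le.1 (hsmall l hl r hr θ)).2
    simp only
    linarith
  obtain ⟨K, hK⟩ := hGd.exists_lipschitzOnWith one_ne_zero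
    ((convex_Icc _ _).prod ((convex_Icc _ _).prod (convex_Icc _ _)))
    (isCompact_Icc.prod (isCompact_Icc.prod isCompact_Icc))
  have h_integral : ∀ x : ℝ, ∫ θ in (0:ℝ)..(2 * π), G (0, x, θ) =
      -x * (2 * ∫ s in (-1:ℝ)..1, √(1 - s ^ 2) * f (x * s)) := by
    intro x
    rw [← integral_comp_cos_mul_sin_sq hf.continuous x, ← intervalIntegral.integral_const_mul]
    refine intervalIntegral.integral_congr fun θ _ ↦ ?_
    simp only [hG, zero_mul, sub_zero, div_one]
    ring
  obtain ⟨l₀, hl₀, h⟩ := exists_periodic_of_average_sign_of_lipschitzOnWith hl₁pos two_pi_pos hδ hK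
    (by rw [h_integral]; exact mul_pos_of_neg_of_neg (by linarith) (by linarith))
    (by rw [h_integral]; exact mul_neg_of_neg_of_pos (by linarith) (by linarith))
  refine ⟨min l₀ l₁, lt_min hl₀ hl₁pos, fun l hl hll ↦ ?_⟩
  obtain ⟨α, hα, hα'⟩ := h l hl (hll.trans_le (min_le_left _ _))
  obtain ⟨R, hRper, hRd, hRα⟩ := exists_periodic_extension (v := fun r θ ↦ l * G (l, r, θ))
    two_pi_pos (fun r θ ↦ by simp only [hG, cos_add_two_pi, sin_add_two_pi]) hα
    (fun θ hθ ↦ (hα' θ hθ).2)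
  have hRρ : ∀ θ, |R θ - ρ| ≤ 2 * δ := fun θ ↦ by
    obtain ⟨φ, hφ, h⟩ := hRα θ
    rw [h]
    exact (hα' φ hφ).1
  have hRmem : ∀ θ, R θ ∈ Icc (ρ - 2 * δ) (ρ + 2 * δ) := fun θ ↦ by
    have := abs_le.1 (hRρ θ)
    exact ⟨by linarith, by linarith⟩
  obtain ⟨x, y, hxy, hrange⟩ := exists_isPeriodicSol_of_polar (f := f) (l := l) hf.continuous hRper
    (fun θ ↦ by linarith [(hRmem θ).1])
    (fun θ ↦ hsmall l ⟨hl.le, (hll.trans_le (min_le_right _ _)).le⟩ _ (hRmem θ) θ) hRd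
  refine ⟨x, y, hxy, ?_⟩
  rw [hrange]
  exact hausdorffDist_polar_le (by linarith) hRρ

end Averaging

theorem limit_cycle_small_lambda (f : ℝ → ℝ) (xM xm : ℝ)
    (hf : ContDiff ℝ 2 f)
    (hxM : xM < 0) (hxm : 0 < xm)
    (hfxM : f xM = 0) (hfxm : f xm = 0)
    (hzeros : ∀ x, f x = 0 → x = xM ∨ x = xm)
    (hdM : deriv f xM < 0) (hdm : 0 < deriv f xm)
    (F : ℝ → ℝ) (hF : ∀ x, F x = ∫ s in (0:ℝ)..x, f s)
    (x₁ x₂ : ℝ) (hx₁ : x₁ < xM) (hx₂ : xm < x₂)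
    (hFx₁ : F x₁ = F xm) (hFx₂ : F x₂ = F xM)
    (hA3 : ∀ lam : ℝ, 0 < lam → ∀ x y x' y' : ℝ → ℝ,
      IsPeriodicSol f lam x y → IsPeriodicSol f lam x' y' →
      Set.range (fun t => (x t, y t)) = Set.range (fun t => (x' t, y' t)))
    (ρ : ℝ) (hρpos : 0 < ρ)
    (hρzero : (∫ s in (-1:ℝ)..1, Real.sqrt (1 - s ^ 2) * f (ρ * s)) = 0)
    (hρuniq : ∀ r : ℝ, 0 < r →
      (∫ s in (-1:ℝ)..1, Real.sqrt (1 - s ^ 2) * f (r * s)) = 0 → r = ρ) :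
    ∀ ε > (0:ℝ), ∃ lam₀ > (0:ℝ), ∀ lam : ℝ, 0 < lam → lam < lam₀ →
      ∃ x y : ℝ → ℝ, IsPeriodicSol f lam x y ∧
        Metric.hausdorffDist (Set.range (fun t => (x t, y t)))
          {p : ℝ × ℝ | p.1 ^ 2 + p.2 ^ 2 = ρ ^ 2} < ε := by
  have hfc := hf.continuous
  obtain ⟨hl, hmid, hr⟩ := sign_of_two_zeros hfc (hxM.trans hxm) hfxM hfxm hzeros hdM hdm
  have hi : ∀ p q : ℝ, IntervalIntegrable f MeasureTheory.volume p q :=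
    fun p q ↦ hfc.intervalIntegrable p q
  have hFdiff : ∀ p q, ∫ s in p..q, f s = F q - F p := fun p q ↦ by
    rw [hF, hF, intervalIntegral.integral_interval_sub_left (hi _ _) (hi _ _)]
  have hFbar : Continuous fun r : ℝ ↦ ∫ s in (-1:ℝ)..1, √(1 - s ^ 2) * f (r * s) :=
    intervalIntegral.continuous_parametric_intervalIntegral_of_continuous' (by fun_prop) _ _
  set p := min (ρ / 2) (min (-xM) xm) with hp
  have hp0 : 0 < p := lt_min (by linarith) (lt_min (by linarith) hxm)
  have hpM : p ≤ -xM := (min_le_right _ _).trans (min_le_left _ _)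
  have hpm : p ≤ xm := (min_le_right _ _).trans (min_le_right _ _)
  have hpρ : p < ρ := (min_le_left _ _).trans_lt (by linarith)
  have hsmall := integral_sqrt_mul_neg_of_small hfc hmid hp0 (by linarith) hpm
  have hlarge := integral_sqrt_mul_pos_of_large (r := ρ + 2 * (x₂ - x₁)) hfc (hxM.trans hxm)
    hx₁ hx₂ hmid
    (fun x hx ↦ hx.eq_or_lt.elim (fun h ↦ by rw [h, hfxM]) fun h ↦ (hl x h).le)
    (fun x hx ↦ hx.eq_or_lt.elim (fun h ↦ by rw [← h, hfxm]) fun h ↦ (hr x h).le)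
    (by rw [hFdiff, hFx₁, sub_self]) (by rw [hFdiff, hFx₂, sub_self])
    (by linarith) (by linarith) (by linarith)
  obtain ⟨hneg, hpos⟩ := sign_of_unique_zero hFbar hρuniq hp0 hpρ hsmall (by linarith) hlarge
  intro ε hε
  set δ := min (ε / 4) (ρ / 4) with hδ
  have hδ0 : 0 < δ := lt_min (by linarith) (by linarith)
  have hδε : δ ≤ ε / 4 := min_le_left _ _
  have hδρ : δ ≤ ρ / 4 := min_le_right _ _
  obtain ⟨l₀, hl₀, h⟩ := limit_cycle_of_averaged_sign_change (hf.of_le one_le_two) hδ0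
    (by linarith) (hneg (ρ - δ) (by linarith) (by linarith)) (hpos (ρ + δ) (by linarith))
  refine ⟨l₀, hl₀, fun l hl0 hll ↦ ?_⟩
  obtain ⟨x, y, hxy, hd⟩ := h l hl0 hll
  exact ⟨x, y, hxy, hd.trans_lt (by linarith)⟩
end

section
/- Assume hypotheses (A1) and (A2). Define the closed curve Γ₀ = {(t, F(x_M)) : t ∈ [x_M, x₂]} ∪ {(t, F(t)) : t ∈ [x_m, x₂]} ∪ {(t, F(x_m)) : t ∈ [x₁, x_m]} ∪ {(t, F(t)) : t ∈ [x₁, x_M]}, and for λ > 0 let P_λ⁻¹(Γ₀) = {(x, λ(u − F(x))) : (x, u) ∈ Γ₀} (the preimage of Γ₀ under the diffeomorphism P_λ(x, y) = (x, F(x) + y/λ)). Then for every ε > 0 there exists λ₁ > 0 such that for every λ > λ₁ the Liénard system (S1) has a nonconstant periodic solution whose image Φ₁(λ) ⊂ ℝ² satisfies d_H(Φ₁(λ), P_λ⁻¹(Γ₀)) < ε. -/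
section

open Set
open scoped Manifold NNReal Topology

/-- A globally Lipschitz `C¹` vector field has global integral curves. -/
theorem exists_global_solution_of_lipschitzWith {E : Type*} [NormedAddCommGroup E]
    [NormedSpace ℝ E] [CompleteSpace E] {V : E → E} {K : ℝ≥0} (hV : LipschitzWith K V)
    (hV' : ContDiff ℝ 1 V) (z₀ : E) :
    ∃ z : ℝ → E, z 0 = z₀ ∧ ∀ t, HasDerivAt z (V (z t)) t := by
  set τ : ℝ := 1 / (2 * (K + 1)) with hτ
  have hK : (0 : ℝ) < 2 * (K + 1) := by positivity
  have hτ0 : 0 < τ := by positivity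
  have hloc : ∀ w : E, ∃ γ : ℝ → E, γ 0 = w ∧
      IsMIntegralCurveOn (I := 𝓘(ℝ, E)) γ V (Ioo (-τ) τ) := by
    intro w
    have h0 : (0 : ℝ) ∈ Icc (-τ) τ := ⟨by linarith, by linarith⟩
    have hPL : IsPicardLindelof (fun _ => V) (⟨0, h0⟩ : Icc (-τ) τ) w
        ‖V w‖₊ 0 ((K + 1) * (2 * ‖V w‖₊)) K := by
      refine ⟨fun t _ => hV.lipschitzOnWith, fun x _ => continuousOn_const, ?_, ?_⟩
      · intro t _ x hx
        have h1 : ‖V x - V w‖ ≤ K * ‖x - w‖ := by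
          simpa [dist_eq_norm] using hV.dist_le_mul x w
        have h2 : ‖x - w‖ ≤ ‖V w‖ := by simpa [dist_eq_norm] using hx
        have h3 : ‖V x‖ ≤ ‖V x - V w‖ + ‖V w‖ := by
          simpa using norm_add_le (V x - V w) (V w)
        have h4 : (K : ℝ) * ‖x - w‖ ≤ K * ‖V w‖ := by gcongr
        have h5 : 0 ≤ (K : ℝ) * ‖V w‖ := by positivity
        push_cast
        nlinarith [norm_nonneg (V w)]
      · push_cast
        simp only [sub_zero, zero_sub, neg_neg, max_self]
        rw [hτ]
        field_simp
        rfl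
    obtain ⟨γ, hγ0, hγ⟩ := hPL.exists_eq_forall_mem_Icc_hasDerivWithinAt₀
    refine ⟨γ, hγ0, fun t ht => ?_⟩
    have := (hγ t (Ioo_subset_Icc_self ht)).mono Ioo_subset_Icc_self
    exact HasFDerivWithinAt.hasMFDerivWithinAt this.hasFDerivWithinAt
  obtain ⟨z, hz0, hz⟩ := exists_isMIntegralCurve_of_isMIntegralCurveOn
    (contMDiff_vectorSpace_iff_contDiff.2 hV') hτ0 hloc z₀
  refine ⟨z, hz0, fun t => ?_⟩
  have h : HasFDerivAt z ((1 : ℝ →L[ℝ] ℝ).smulRight (V (z t)) : ℝ →L[ℝ] E) t :=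
    hasMFDerivAt_iff_hasFDerivAt.1 (hz t)
  simpa using h.hasDerivAt

/-- `(x, y)` solves `x' = y`, `y' = -x - lam * f x * y` for all times. -/
def IsLienardSol (f : ℝ → ℝ) (lam : ℝ) (x y : ℝ → ℝ) : Prop :=
  (∀ t, HasDerivAt x (y t) t) ∧ ∀ t, HasDerivAt y (-(x t) - lam * f (x t) * y t) t

/-- The Liénard vector field in the coordinates `(x, v)` with `v = y + lam * F x`. -/
def lienardField (F : ℝ → ℝ) (lam : ℝ) (z : ℝ × ℝ) : ℝ × ℝ := (z.2 - lam * F z.1, -z.1)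

theorem exists_lipschitzWith_lienardField {f F : ℝ → ℝ} (hF : ∀ s, HasDerivAt F (f s) s)
    {C : ℝ≥0} (hC : ∀ s, ‖f s‖₊ ≤ C) (lam : ℝ) :
    ∃ K, LipschitzWith K (lienardField F lam) := by
  have hFL : LipschitzWith C F :=
    lipschitzWith_of_nnnorm_deriv_le (fun s => (hF s).differentiableAt)
      (fun s => by rw [(hF s).deriv]; exact hC s)
  have h1 : LipschitzWith _ (fun z : ℝ × ℝ => lam * F z.1) :=
    (lipschitzWith_smul lam).comp (hFL.comp LipschitzWith.prod_fst)
  exact ⟨_, (LipschitzWith.prod_snd.sub h1).prodMk (LipschitzWith.prod_fst.neg)⟩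

theorem IsLienardSol.hasDerivAt_field {f F : ℝ → ℝ} {lam : ℝ} {x y : ℝ → ℝ}
    (hF : ∀ s, HasDerivAt F (f s) s) (h : IsLienardSol f lam x y) (t : ℝ) :
    HasDerivAt (fun t => (x t, y t + lam * F (x t)))
      (lienardField F lam (x t, y t + lam * F (x t))) t := by
  have hv : HasDerivAt (fun t => y t + lam * F (x t)) (-(x t)) t := by
    refine ((h.2 t).add (((hF (x t)).comp t (h.1 t)).const_mul lam)).congr_deriv ?_
    ring
  refine ((h.1 t).prodMk hv).congr_deriv ?_
  simp [lienardField]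

theorem exists_isLienardSol {f F : ℝ → ℝ} (hF : ∀ s, HasDerivAt F (f s) s) (hf : Continuous f)
    {C : ℝ≥0} (hC : ∀ s, ‖f s‖₊ ≤ C) (lam a : ℝ) :
    ∃ x y : ℝ → ℝ, IsLienardSol f lam x y ∧ x 0 = a ∧ y 0 = 0 := by
  obtain ⟨K, hK⟩ := exists_lipschitzWith_lienardField hF hC lam
  have hF1 : ContDiff ℝ 1 F := by
    rw [contDiff_one_iff_deriv]
    exact ⟨fun s => (hF s).differentiableAt, by rwa [funext fun s => (hF s).deriv]⟩
  have hsm : ContDiff ℝ 1 (lienardField F lam) := by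
    unfold lienardField
    fun_prop
  obtain ⟨z, hz0, hz⟩ := exists_global_solution_of_lipschitzWith hK hsm (a, lam * F a)
  have hx : ∀ t, HasDerivAt (fun t => (z t).1) ((z t).2 - lam * F (z t).1) t := fun t =>
    (hz t).fst
  have hv : ∀ t, HasDerivAt (fun t => (z t).2) (-(z t).1) t := fun t => (hz t).snd
  refine ⟨fun t => (z t).1, fun t => (z t).2 - lam * F (z t).1, ⟨hx, fun t => ?_⟩,
    by simp [hz0], by simp [hz0]⟩
  refine ((hv t).sub (((hF _).comp t (hx t)).const_mul lam)).congr_deriv ?_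
  ring

theorem IsLienardSol.comp_add {f : ℝ → ℝ} {lam : ℝ} {x y : ℝ → ℝ}
    (h : IsLienardSol f lam x y) (s : ℝ) :
    IsLienardSol f lam (fun t => x (t + s)) (fun t => y (t + s)) :=
  ⟨fun t => (h.1 (t + s)).comp_add_const t s, fun t => (h.2 (t + s)).comp_add_const t s⟩

theorem IsLienardSol.neg {f : ℝ → ℝ} {lam : ℝ} {x y : ℝ → ℝ} (h : IsLienardSol f lam x y) :
    IsLienardSol (fun s => f (-s)) lam (fun t => -x t) (fun t => -y t) :=
  ⟨fun t => (h.1 t).neg, fun t => (h.2 t).neg.congr_deriv (by simp only [neg_neg]; ring)⟩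

/-- Two solutions through the same point agree up to a time shift. -/
theorem IsLienardSol.unique {f F : ℝ → ℝ} (hF : ∀ s, HasDerivAt F (f s) s)
    {C : ℝ≥0} (hC : ∀ s, ‖f s‖₊ ≤ C) {lam : ℝ} {x y x' y' : ℝ → ℝ}
    (h : IsLienardSol f lam x y) (h' : IsLienardSol f lam x' y') {t₁ t₂ : ℝ}
    (hx : x t₁ = x' t₂) (hy : y t₁ = y' t₂) (s : ℝ) :
    x (s + t₁) = x' (s + t₂) ∧ y (s + t₁) = y' (s + t₂) := by
  obtain ⟨K, hK⟩ := exists_lipschitzWith_lienardField hF hC lam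
  have := ODE_solution_unique_univ (v := fun _ => lienardField F lam) (s := fun _ => univ)
    (t₀ := 0) (fun _ => hK.lipschitzOnWith)
    (fun t => ⟨(h.comp_add t₁).hasDerivAt_field hF t, mem_univ _⟩)
    (fun t => ⟨(h'.comp_add t₂).hasDerivAt_field hF t, mem_univ _⟩) (by simp [hx, hy])
  have h1 := congrFun this s
  simp only [Prod.mk.injEq] at h1
  refine ⟨h1.1, ?_⟩
  have h2 := h1.2
  rw [h1.1] at h2
  linarith

theorem le_of_hasDerivAt_nonpos {g g' : ℝ → ℝ} (hg : ∀ t, HasDerivAt g (g' t) t) {s t : ℝ}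
    (hst : s ≤ t) (h : ∀ u ∈ Ioo s t, g' u ≤ 0) : g t ≤ g s := by
  refine antitoneOn_of_deriv_nonpos (convex_Icc s t)
    (fun u _ => (hg u).continuousAt.continuousWithinAt)
    (fun u _ => (hg u).differentiableAt.differentiableWithinAt) (fun u hu => ?_)
    (left_mem_Icc.2 hst) (right_mem_Icc.2 hst) hst
  rw [interior_Icc] at hu
  rw [(hg u).deriv]
  exact h u hu

theorem le_of_hasDerivAt_nonneg {g g' : ℝ → ℝ} (hg : ∀ t, HasDerivAt g (g' t) t) {s t : ℝ}
    (hst : s ≤ t) (h : ∀ u ∈ Ioo s t, 0 ≤ g' u) : g s ≤ g t := by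
  have := le_of_hasDerivAt_nonpos (fun t => (hg t).neg) hst (fun u hu => by linarith [h u hu])
  simpa using this

namespace IsLienardSol

variable {f F : ℝ → ℝ} {lam : ℝ} {x y : ℝ → ℝ}

theorem continuous_fst (h : IsLienardSol f lam x y) : Continuous x :=
  continuous_iff_continuousAt.2 fun t => (h.1 t).continuousAt

theorem continuous_snd (h : IsLienardSol f lam x y) : Continuous y :=
  continuous_iff_continuousAt.2 fun t => (h.2 t).continuousAt

theorem strictMonoOn (h : IsLienardSol f lam x y) {τ : ℝ} (hy : ∀ t ∈ Ioo 0 τ, 0 < y t) :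
    StrictMonoOn x (Icc 0 τ) := by
  refine strictMonoOn_of_deriv_pos (convex_Icc 0 τ) h.continuous_fst.continuousOn fun u hu => ?_
  rw [interior_Icc] at hu
  rw [(h.1 u).deriv]
  exact hy u hu

/-- On an arc in the upper half plane, `y` is a continuous function of `x`. -/
theorem exists_graph (h : IsLienardSol f lam x y) {T : ℝ} (hT : 0 < T)
    (hy : ∀ t ∈ Ioo 0 T, 0 < y t) :
    ∃ g : ℝ → ℝ, Continuous g ∧ ∀ t ∈ Icc 0 T, g (x t) = y t := by
  have hm := h.strictMonoOn hy
  have him : x '' Icc 0 T = Icc (x 0) (x T) := by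
    apply Subset.antisymm
    · rintro _ ⟨t, ht, rfl⟩
      exact ⟨hm.monotoneOn (left_mem_Icc.2 hT.le) ht ht.1,
        hm.monotoneOn ht (right_mem_Icc.2 hT.le) ht.2⟩
    · exact intermediate_value_Icc hT.le h.continuous_fst.continuousOn
  have hle : x 0 ≤ x T := (hm (left_mem_Icc.2 hT.le) (right_mem_Icc.2 hT.le) hT).le
  let e : Icc 0 T ≃o Icc (x 0) (x T) := (hm.orderIso x (Icc 0 T)).trans (OrderIso.setCongr _ _ him)
  have he : ∀ t : Icc 0 T, (e t : ℝ) = x t := fun t => rfl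
  refine ⟨IccExtend hle fun s => y (e.symm s), ?_, fun t ht => ?_⟩
  · exact ((h.continuous_snd.comp continuous_subtype_val).comp e.symm.continuous).Icc_extend'
  · have h1 : e ⟨t, ht⟩ = ⟨x t, him ▸ mem_image_of_mem x ht⟩ := Subtype.ext (he _)
    rw [IccExtend_of_mem hle _ (him ▸ mem_image_of_mem x ht), ← h1, OrderIso.symm_apply_apply]

/-- The endpoint of an arc in the upper half plane depends antitonically on its start. -/
theorem endpoint_le (hF : ∀ s, HasDerivAt F (f s) s) {C : ℝ≥0} (hC : ∀ s, ‖f s‖₊ ≤ C)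
    {x' y' : ℝ → ℝ} (h : IsLienardSol f lam x y) (h' : IsLienardSol f lam x' y') {T T' : ℝ}
    (hT : 0 < T) (hT' : 0 < T') (hy : ∀ t ∈ Ioo 0 T, 0 < y t) (hy' : ∀ t ∈ Ioo 0 T', 0 < y' t)
    (hy0 : y 0 = 0) (hyT : y T = 0) (hy0' : y' 0 = 0) (h0 : x 0 < x' 0)
    (h1 : x' 0 < x T) : x' T' ≤ x T := by
  by_contra! hlt
  have hm := h.strictMonoOn hy
  have hm' := h'.strictMonoOn hy'
  obtain ⟨g, hg, hgx⟩ := h.exists_graph hT hy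
  obtain ⟨g', hg', hgx'⟩ := h'.exists_graph hT' hy'
  have hs : ∀ s ∈ Icc (x' 0) (x T), ∃ t ∈ Icc 0 T, x t = s := fun s hs =>
    intermediate_value_Icc hT.le h.continuous_fst.continuousOn ⟨h0.le.trans hs.1, hs.2⟩
  have hs' : ∀ s ∈ Icc (x' 0) (x T), ∃ t ∈ Icc 0 T', x' t = s := fun s hs =>
    intermediate_value_Icc hT'.le h'.continuous_fst.continuousOn ⟨hs.1, hs.2.trans hlt.le⟩
  have hpos : ∀ t ∈ Icc 0 T, 0 ≤ y t := fun t ht => by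
    rcases ht.1.eq_or_lt with h2 | h2
    · rw [← h2, hy0]
    rcases ht.2.eq_or_lt with h3 | h3
    · rw [h3, hyT]
    exact (hy t ⟨h2, h3⟩).le
  obtain ⟨s, hsm, hsg⟩ : ∃ s ∈ Icc (x' 0) (x T), g' s = g s := by
    refine isPreconnected_Icc.intermediate_value₂ (left_mem_Icc.2 h1.le) (right_mem_Icc.2 h1.le)
      hg'.continuousOn hg.continuousOn ?_ ?_
    · rw [hgx' 0 (left_mem_Icc.2 hT'.le), hy0']
      obtain ⟨t, ht, hxt⟩ := hs _ (left_mem_Icc.2 h1.le)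
      rw [← hxt, hgx t ht]
      exact hpos t ht
    · rw [hgx T (right_mem_Icc.2 hT.le), hyT]
      obtain ⟨t, ht, hxt⟩ := hs' _ (right_mem_Icc.2 h1.le)
      rw [← hxt, hgx' t ht]
      rcases ht.1.eq_or_lt with h2 | h2
      · rw [← h2, hy0']
      refine (hy' t ⟨h2, lt_of_le_of_ne ht.2 fun h3 => ?_⟩).le
      rw [h3] at hxt
      exact hlt.ne' hxt
  obtain ⟨t, ht, hxt⟩ := hs s hsm
  obtain ⟨t', ht', hxt'⟩ := hs' s hsm
  have hyy : y t = y' t' := by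
    rw [← hgx t ht, ← hgx' t' ht', hxt, hxt', hsg]
  have key := h.unique hF hC h' (hxt.trans hxt'.symm) hyy
  rcases le_total t t' with hle | hle
  · obtain ⟨k1, k2⟩ := key (-t)
    rw [neg_add_cancel] at k1 k2
    rcases hle.eq_or_lt with h2 | h2
    · rw [h2, neg_add_cancel] at k1
      exact h0.ne k1
    · rcases lt_or_ge (-t + t') T' with h3 | h3
      · have := hy' (-t + t') ⟨by linarith, h3⟩
        linarith
      · have : x' 0 < x' (-t + t') := hm' (left_mem_Icc.2 hT'.le)
          ⟨by linarith, by linarith [ht.1, ht'.2]⟩ (by linarith)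
        linarith
  · obtain ⟨k1, k2⟩ := key (-t')
    rw [neg_add_cancel] at k1 k2
    rcases hle.eq_or_lt with h2 | h2
    · rw [h2, neg_add_cancel] at k1
      exact h0.ne k1
    · rcases lt_or_ge (-t' + t) T with h3 | h3
      · have := hy (-t' + t) ⟨by linarith, h3⟩
        linarith
      · have : -t' + t = T := le_antisymm (by linarith [ht.2, ht'.1]) h3
        rw [this] at k1
        exact h1.ne' k1

end IsLienardSol

/-- `q` is a local maximum point of `F = ∫ f`, increasing to the left of `q`; the horizontal line
through the maximum stays above the graph of `F` until it reaches a rising branch at `r`. -/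
structure JumpData (f F : ℝ → ℝ) (p q r δ : ℝ) : Prop where
  hasDerivAt : ∀ s, HasDerivAt F (f s) s
  continuous : Continuous f
  q_neg : q < 0
  δ_pos : 0 < δ
  p_lt : p + 2 * δ < q
  δ_lt : δ < r
  pos_left : ∀ s, s < q → 0 < f s
  lt_mid : ∀ s, q < s → s < r → F s < F q
  eq_right : F r = F q
  pos_right : ∀ s, r - δ ≤ s → 0 < f s

/-- Quantitative constants for which the relaxation estimates hold. -/
structure JumpConst (f F : ℝ → ℝ) (p q r δ η c m lam : ℝ) : Prop where
  η_pos : 0 < η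
  η_le : η ≤ δ
  η_lt : q + η < 0
  η_sq : 4 * (δ - p) * η ≤ δ ^ 2 / 4
  c_le : ∀ s ∈ Icc (p - δ) (q - η), c ≤ f s
  m_pos : 0 < m
  m_le : ∀ s ∈ Icc (q + η) (r - δ), m ≤ F q - F s
  lam_pos : 0 < lam
  lam_c : δ - p < lam * c * (δ / 2)
  lam_m : (δ - p) * (δ - p) ≤ lam * m * (δ / 4)
  lam_m' : r * r < δ * (lam * m - δ)
  lam_r : δ < lam * (F (r + δ) - F q)

namespace JumpData

variable {f F : ℝ → ℝ} {p q r δ : ℝ}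

theorem strictMonoOn_right (D : JumpData f F p q r δ) : StrictMonoOn F (Ici (r - δ)) := by
  refine strictMonoOn_of_deriv_pos (convex_Ici _)
    (fun s _ => (D.hasDerivAt s).continuousAt.continuousWithinAt) fun s hs => ?_
  rw [(D.hasDerivAt s).deriv]
  exact D.pos_right s (interior_subset hs)

theorem le_left (D : JumpData f F p q r δ) {s : ℝ} (hs : s ≤ q) : F s ≤ F q :=
  le_of_hasDerivAt_nonneg D.hasDerivAt hs fun u hu => (D.pos_left u hu.2).le

theorem le_mid (D : JumpData f F p q r δ) {s : ℝ} (hs : q ≤ s) (hs' : s ≤ r) : F s ≤ F q := by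
  rcases hs.eq_or_lt with h | h
  · rw [h]
  rcases hs'.eq_or_lt with h' | h'
  · rw [h', D.eq_right]
  exact (D.lt_mid s h h').le

theorem exists_const (D : JumpData f F p q r δ) :
    ∃ η c m lam₁, 0 < lam₁ ∧ ∀ lam, lam₁ < lam → JumpConst f F p q r δ η c m lam := by
  have hδ := D.δ_pos
  have hA : 0 < δ - p := by linarith [D.p_lt, D.q_neg]
  have hFc : Continuous F := continuous_iff_continuousAt.2 fun s => (D.hasDerivAt s).continuousAt
  obtain ⟨η, hη0, hη1, hη2, hη3⟩ : ∃ η, 0 < η ∧ η ≤ δ ∧ q + η < 0 ∧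
      4 * (δ - p) * η ≤ δ ^ 2 / 4 := by
    refine ⟨min (min δ (-q / 2)) (δ ^ 2 / (16 * (δ - p))), ?_, ?_, ?_, ?_⟩
    · have : 0 < -q / 2 := by linarith [D.q_neg]
      positivity
    · exact (min_le_left _ _).trans (min_le_left _ _)
    · have := (min_le_left (min δ (-q / 2)) (δ ^ 2 / (16 * (δ - p)))).trans (min_le_right _ _)
      linarith [D.q_neg]
    · have := min_le_right (min δ (-q / 2)) (δ ^ 2 / (16 * (δ - p)))
      rw [le_div_iff₀ (by positivity)] at this
      linarith
  obtain ⟨s₁, hs₁, hs₁'⟩ := (isCompact_Icc (a := p - δ) (b := q - η)).exists_isMinOn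
    ⟨p - δ, le_rfl, by linarith [D.p_lt]⟩ D.continuous.continuousOn
  obtain ⟨s₂, hs₂, hs₂'⟩ := (isCompact_Icc (a := q + η) (b := r - δ)).exists_isMinOn
    (f := fun s => F q - F s) ⟨q + η, le_rfl, by linarith [D.δ_lt]⟩
    (continuous_const.sub hFc).continuousOn
  have hc : 0 < f s₁ := D.pos_left _ (by linarith [hs₁.2])
  have hm : 0 < F q - F s₂ := sub_pos.2 (D.lt_mid _ (by linarith [hs₂.1]) (by linarith [hs₂.2]))
  have hr : 0 < F (r + δ) - F q := by
    rw [← D.eq_right]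
    exact sub_pos.2 (D.strictMonoOn_right (by simp [hδ.le]) (mem_Ici.2 (by linarith))
      (by linarith))
  set A := δ - p
  set c := f s₁
  set m := F q - F s₂
  set d := F (r + δ) - F q with hd
  have ev : ∀ᶠ lam : ℝ in Filter.atTop, 0 < lam ∧ A / (c * (δ / 2)) < lam ∧
      A * A / (m * (δ / 4)) < lam ∧ (r * r / δ + δ) / m < lam ∧ δ / d < lam := by
    refine (Filter.eventually_gt_atTop _).and <| (Filter.eventually_gt_atTop _).and <|
      (Filter.eventually_gt_atTop _).and <| (Filter.eventually_gt_atTop _).and <|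
      Filter.eventually_gt_atTop _
  obtain ⟨L, hL⟩ := Filter.eventually_atTop.1 ev
  refine ⟨η, c, m, max L 1, by positivity, fun lam hlam => ?_⟩
  obtain ⟨h0, h1, h2, h3, h4⟩ := hL lam ((le_max_left _ _).trans hlam.le)
  rw [div_lt_iff₀ (by positivity)] at h1 h2 h3 h4
  refine ⟨hη0, hη1, hη2, hη3, fun s hs => hs₁' hs, hm, fun s hs => hs₂' hs, h0, by linarith,
    by linarith, ?_, h4⟩
  have h5 : r * r / δ < lam * m - δ := by linarith
  rw [div_lt_iff₀ hδ] at h5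
  linarith

variable {η c m lam : ℝ} {x y : ℝ → ℝ} {τ : ℝ}

/-- The situation of an orbit which starts near `(p, 0)` and stays in the upper half plane up to
time `τ`. -/
structure Arc (f F : ℝ → ℝ) (p q r δ η c m lam : ℝ) (x y : ℝ → ℝ) (τ : ℝ) : Prop where
  data : JumpData f F p q r δ
  const : JumpConst f F p q r δ η c m lam
  sol : IsLienardSol f lam x y
  start_ge : p - δ ≤ x 0
  start_le : x 0 ≤ p + δ
  start : y 0 = 0
  pos : ∀ t ∈ Ioo 0 τ, 0 < y t

namespace Arc

theorem nonneg (A : Arc f F p q r δ η c m lam x y τ) {t : ℝ} (ht : t ∈ Icc 0 τ) : 0 ≤ y t := by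
  rcases ht.1.eq_or_lt with h | h
  · rw [← h, A.start]
  have h1 : Icc 0 t ⊆ {u | 0 ≤ y u} := by
    rw [← closure_Ioo h.ne]
    refine closure_minimal (fun u hu => ?_) (isClosed_le continuous_const A.sol.continuous_snd)
    exact (A.pos u ⟨hu.1, hu.2.trans_le ht.2⟩).le
  exact h1 ⟨h.le, le_rfl⟩

theorem mono (A : Arc f F p q r δ η c m lam x y τ) {s t : ℝ} (hs : 0 ≤ s) (hst : s ≤ t)
    (ht : t ≤ τ) : x s ≤ x t :=
  (A.sol.strictMonoOn A.pos).monotoneOn ⟨hs, hst.trans ht⟩ ⟨hs.trans hst, ht⟩ hst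

theorem exists_time (A : Arc f F p q r δ η c m lam x y τ) {s t : ℝ} (ht : t ∈ Icc 0 τ)
    (h0 : x 0 ≤ s) (hs : s ≤ x t) : ∃ t₀, 0 ≤ t₀ ∧ t₀ ≤ t ∧ x t₀ = s := by
  obtain ⟨t₀, h1, h2⟩ := intermediate_value_Icc ht.1 A.sol.continuous_fst.continuousOn ⟨h0, hs⟩
  exact ⟨t₀, h1.1, h1.2, h2⟩

/-- The deviation of the orbit from the horizontal jump. -/
theorem hasDerivAt_dev (A : Arc f F p q r δ η c m lam x y τ) (t : ℝ) :
    HasDerivAt (fun t => y t - lam * (F q - F (x t))) (-(x t)) t := by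
  refine ((A.sol.2 t).sub ((((A.data.hasDerivAt (x t)).comp t (A.sol.1 t)).const_sub
    (F q)).const_mul lam)).congr_deriv ?_
  ring

theorem le_of_le_sub (A : Arc f F p q r δ η c m lam x y τ) {t : ℝ} (ht : t ∈ Icc 0 τ)
    (hx : x t ≤ q - η) : y t ≤ δ / 2 := by
  have hδ := A.data.δ_pos
  refine image_le_of_deriv_right_lt_deriv_boundary' (B := fun _ => δ / 2) (B' := fun _ => 0)
    A.sol.continuous_snd.continuousOn
    (fun u _ => (A.sol.2 u).hasDerivWithinAt) (by simp only [A.start]; linarith)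
    continuousOn_const (fun u _ => hasDerivWithinAt_const _ _ _) ?_ (right_mem_Icc.2 ht.1)
  intro u hu hyu
  have h1 := A.mono le_rfl hu.1 (hu.2.le.trans ht.2)
  have h2 := A.mono hu.1 hu.2.le ht.2
  have h3 := A.const.c_le (x u) ⟨A.start_ge.trans h1, h2.trans hx⟩
  have h4 := A.const.lam_c
  have h5 : lam * c * (δ / 2) ≤ lam * f (x u) * (δ / 2) := by
    have := A.const.lam_pos
    gcongr
  rw [hyu]
  linarith [A.start_ge]

theorem sq_le_of_le (A : Arc f F p q r δ η c m lam x y τ) {t : ℝ} (ht : t ∈ Icc 0 τ)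
    (hx : x t ≤ q) : y t ^ 2 ≤ δ ^ 2 / 4 + 2 * (δ - p) * η := by
  have hδ := A.data.δ_pos
  have hp := A.data.p_lt
  have hq := A.data.q_neg
  have hη := A.const.η_pos
  have hA : 0 < δ - p := by linarith
  rcases le_total (x t) (q - η) with h | h
  · have := A.le_of_le_sub ht h
    have h0 := A.nonneg ht
    have : y t ^ 2 ≤ (δ / 2) ^ 2 := by gcongr
    have : 0 < 2 * (δ - p) * η := by positivity
    nlinarith
  obtain ⟨t₀, h0, h1, h2⟩ := A.exists_time ht
    (by linarith [A.start_le, A.const.η_le]) h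
  have h3 := A.le_of_le_sub ⟨h0, h1.trans ht.2⟩ h2.le
  have h3' := A.nonneg ⟨h0, h1.trans ht.2⟩
  have h4 := le_of_hasDerivAt_nonpos (fun u => ((A.sol.2 u).pow 2).sub
    ((A.sol.1 u).const_mul (2 * (δ - p)))) h1 (fun u hu => by
      have hu0 : 0 ≤ u := h0.trans hu.1.le
      have hut : u ≤ τ := hu.2.le.trans ht.2
      have k1 := A.mono le_rfl hu0 hut
      have k2 := A.nonneg ⟨hu0, hut⟩
      have k3 : x u < x t := A.sol.strictMonoOn A.pos ⟨hu0, hut⟩ ht hu.2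
      have k4 := A.data.pos_left (x u) (k3.trans_le hx)
      have k5 : 0 ≤ lam * f (x u) * y u := by
        have := A.const.lam_pos
        positivity
      have k6 : 0 ≤ y u * (δ - p + x u + lam * f (x u) * y u) :=
        mul_nonneg k2 (by linarith [A.start_ge])
      norm_num
      linarith)
  simp only [Pi.sub_apply, Pi.pow_apply] at h4
  rw [h2] at h4
  have h5 : y t₀ ^ 2 ≤ (δ / 2) ^ 2 := by gcongr
  have h6 : 2 * (δ - p) * (x t - (q - η)) ≤ 2 * (δ - p) * η := by gcongr; linarith
  linarith

theorem le_of_le (A : Arc f F p q r δ η c m lam x y τ) {t : ℝ} (ht : t ∈ Icc 0 τ)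
    (hx : x t ≤ q) : y t ≤ δ := by
  have h1 := A.sq_le_of_le ht hx
  have h2 := A.const.η_sq
  have hδ := A.data.δ_pos
  nlinarith [sq_nonneg δ]

theorem dev_nonneg (A : Arc f F p q r δ η c m lam x y τ) {t : ℝ} (ht : t ∈ Icc 0 τ)
    (hx : q ≤ x t) (hx' : x t ≤ 0) : 0 ≤ y t - lam * (F q - F (x t)) := by
  obtain ⟨t₀, h0, h1, h2⟩ := A.exists_time ht
    (by linarith [A.start_le, A.data.p_lt, A.data.δ_pos]) hx
  have h3 := le_of_hasDerivAt_nonneg A.hasDerivAt_dev h1 (fun u hu => by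
    linarith [A.mono (h0.trans hu.1.le) hu.2.le ht.2])
  have h4 := A.nonneg ⟨h0, h1.trans ht.2⟩
  simp only [h2, sub_self, mul_zero, sub_zero] at h3
  linarith

theorem dev_le_near (A : Arc f F p q r δ η c m lam x y τ) {t : ℝ} (ht : t ∈ Icc 0 τ)
    (hx : q ≤ x t) (hx' : x t ≤ q + η) : y t - lam * (F q - F (x t)) ≤ 3 * δ / 4 := by
  have hδ := A.data.δ_pos
  have hA : 0 < δ - p := by linarith [A.data.p_lt, A.data.q_neg]
  obtain ⟨t₀, h0, h1, h2⟩ := A.exists_time ht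
    (by linarith [A.start_le, A.data.p_lt, A.data.δ_pos]) hx
  have h3 := A.sq_le_of_le ⟨h0, h1.trans ht.2⟩ h2.le
  have h4 := le_of_hasDerivAt_nonpos (fun u => ((A.hasDerivAt_dev u).pow 2).sub
    ((A.sol.1 u).const_mul (2 * (δ - p)))) h1 (fun u hu => by
      have hu0 : 0 ≤ u := h0.trans hu.1.le
      have hut : u ≤ τ := hu.2.le.trans ht.2
      have k1 := A.mono le_rfl hu0 hut
      have k2 : q ≤ x u := h2 ▸ A.mono h0 hu.1.le hut
      have k3 := A.mono hu0 hu.2.le ht.2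
      have k4 : x u ≤ 0 := k3.trans (hx'.trans A.const.η_lt.le)
      have k5 := A.dev_nonneg ⟨hu0, hut⟩ k2 k4
      have k6 := A.data.le_mid k2 (by linarith [A.data.δ_lt])
      have k7 : 0 ≤ lam * (F q - F (x u)) := mul_nonneg A.const.lam_pos.le (by linarith)
      have k8 : (y u - lam * (F q - F (x u))) * (-(x u)) ≤
          (y u - lam * (F q - F (x u))) * (δ - p) :=
        mul_le_mul_of_nonneg_left (by linarith [A.start_ge]) k5
      have k9 : (y u - lam * (F q - F (x u))) * (δ - p) ≤ y u * (δ - p) :=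
        mul_le_mul_of_nonneg_right (by linarith) hA.le
      norm_num
      linarith)
  simp only [Pi.sub_apply, Pi.pow_apply] at h4
  simp only [h2, sub_self, mul_zero, sub_zero] at h4
  have h5 := A.const.η_sq
  have h6 : 2 * (δ - p) * (x t - q) ≤ 2 * (δ - p) * η := by gcongr; linarith
  have h7 : (y t - lam * (F q - F (x t))) ^ 2 ≤ δ ^ 2 / 2 := by linarith
  nlinarith [sq_nonneg δ]

theorem dev_le (A : Arc f F p q r δ η c m lam x y τ) {t : ℝ} (ht : t ∈ Icc 0 τ)
    (hx : q ≤ x t) : y t - lam * (F q - F (x t)) ≤ δ := by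
  have hδ := A.data.δ_pos
  have hp := A.data.p_lt
  have hq := A.data.q_neg
  have hη := A.const.η_pos
  have hlt := A.const.η_lt
  have hA : 0 < δ - p := by linarith
  have hlm : 0 < lam * m := mul_pos A.const.lam_pos A.const.m_pos
  -- up to the vertical axis
  have key : ∀ s ∈ Icc 0 τ, q ≤ x s → x s ≤ 0 → y s - lam * (F q - F (x s)) ≤ δ := by
    intro s hs hxs hxs'
    rcases le_total (x s) (q + η) with h | h
    · linarith [A.dev_le_near hs hxs h]
    obtain ⟨t₀, h0, h1, h2⟩ := A.exists_time hs (by linarith [A.start_le]) h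
    have h3 := A.dev_le_near ⟨h0, h1.trans hs.2⟩ (by linarith) h2.le
    have h4 := le_of_hasDerivAt_nonpos (fun u => (A.hasDerivAt_dev u).sub
      ((A.sol.1 u).const_mul ((δ - p) / (lam * m)))) h1 (fun u hu => by
        have hu0 : 0 ≤ u := h0.trans hu.1.le
        have hut : u ≤ τ := hu.2.le.trans hs.2
        have k1 := A.mono le_rfl hu0 hut
        have k2 : q + η ≤ x u := h2 ▸ A.mono h0 hu.1.le hut
        have k3 := A.mono hu0 hu.2.le hs.2
        have k4 : x u ≤ 0 := k3.trans hxs'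
        have k5 := A.dev_nonneg ⟨hu0, hut⟩ (by linarith) k4
        have k6 := A.const.m_le (x u) ⟨k2, by linarith [A.data.δ_lt]⟩
        have k7 : lam * m ≤ lam * (F q - F (x u)) := mul_le_mul_of_nonneg_left k6
          A.const.lam_pos.le
        have k8 : (δ - p) / (lam * m) * (lam * m) ≤ (δ - p) / (lam * m) * y u :=
          mul_le_mul_of_nonneg_left (by linarith) (by positivity)
        rw [div_mul_cancel₀ _ hlm.ne'] at k8
        linarith [A.start_ge])
    simp only [Pi.sub_apply] at h4
    have h5 : (δ - p) / (lam * m) * (x s - x t₀) ≤ (δ - p) / (lam * m) * (δ - p) :=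
      mul_le_mul_of_nonneg_left (by linarith) (by positivity)
    have h6 : (δ - p) / (lam * m) * (δ - p) ≤ δ / 4 := by
      rw [div_mul_eq_mul_div, div_le_iff₀ hlm]
      linarith [A.const.lam_m]
    linarith
  rcases le_total (x t) 0 with h | h
  · exact key t ht hx h
  obtain ⟨t₀, h0, h1, h2⟩ := A.exists_time ht (by linarith [A.start_le]) h
  have h3 := key t₀ ⟨h0, h1.trans ht.2⟩ (by linarith) h2.le
  have h4 := le_of_hasDerivAt_nonpos A.hasDerivAt_dev h1 (fun u hu => by
    linarith [A.mono h0 hu.1.le (hu.2.le.trans ht.2)])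
  linarith

theorem neg_le_dev (A : Arc f F p q r δ η c m lam x y τ) {t : ℝ} (ht : t ∈ Icc 0 τ)
    (hx : q ≤ x t) (hx' : x t ≤ r - δ) : -δ ≤ y t - lam * (F q - F (x t)) := by
  have hδ := A.data.δ_pos
  have hr : 0 < r := hδ.trans A.data.δ_lt
  have hq := A.data.q_neg
  rcases le_total (x t) 0 with h | h
  · linarith [A.dev_nonneg ht hx h]
  obtain ⟨t₀, h0, h1, h2⟩ := A.exists_time ht
    (by linarith [A.start_le, A.data.p_lt]) h
  have h3 := A.dev_nonneg ⟨h0, h1.trans ht.2⟩ (by linarith) h2.le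
  have hd := fun u => (A.hasDerivAt_dev u).neg
  have hB := fun u => (A.sol.1 u).const_mul (δ / r)
  have h4 := image_le_of_deriv_right_lt_deriv_boundary' (a := t₀) (b := t)
    (fun u _ => (hd u).continuousAt.continuousWithinAt) (fun u _ => (hd u).hasDerivWithinAt)
    (by simp only [Pi.neg_apply]; rw [h2] at h3 ⊢; linarith)
    (fun u _ => (hB u).continuousAt.continuousWithinAt) (fun u _ => (hB u).hasDerivWithinAt)
    (fun u hu heq => by
      have hu0 : 0 ≤ u := h0.trans hu.1
      have hut : u ≤ τ := hu.2.le.trans ht.2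
      have k1 : 0 ≤ x u := h2 ▸ A.mono h0 hu.1 hut
      have k2 := A.mono hu0 hu.2.le ht.2
      simp only [Pi.neg_apply] at heq
      have k3 := A.const.m_le (x u) ⟨by linarith [A.const.η_lt], by linarith⟩
      have k4 : lam * m ≤ lam * (F q - F (x u)) := mul_le_mul_of_nonneg_left k3
        A.const.lam_pos.le
      have k5 : δ / r * x u ≤ δ := by
        rw [div_mul_eq_mul_div, div_le_iff₀ hr]
        exact mul_le_mul_of_nonneg_left (by linarith) hδ.le
      have k6 : δ / r * (lam * m - δ) ≤ δ / r * y u :=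
        mul_le_mul_of_nonneg_left (by linarith) (by positivity)
      have k7 : r < δ / r * (lam * m - δ) := by
        rw [div_mul_eq_mul_div, lt_div_iff₀ hr]
        exact A.const.lam_m'
      linarith)
    (right_mem_Icc.2 h1)
  simp only [Pi.neg_apply] at h4
  have k5 : δ / r * x t ≤ δ := by
    rw [div_mul_eq_mul_div, div_le_iff₀ hr]
    exact mul_le_mul_of_nonneg_left (by linarith) hδ.le
  linarith

theorem lt_right (A : Arc f F p q r δ η c m lam x y τ) {t : ℝ} (ht : t ∈ Icc 0 τ) :
    x t < r + δ := by
  by_contra! h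
  have hq := A.data.q_neg
  have hδ := A.data.δ_pos
  obtain ⟨t₀, h0, h1, h2⟩ := A.exists_time ht
    (by linarith [A.start_le, A.data.p_lt, A.data.δ_lt]) h
  have h3 := A.dev_le ⟨h0, h1.trans ht.2⟩ (by linarith [A.data.δ_lt])
  have h4 := A.nonneg ⟨h0, h1.trans ht.2⟩
  have h5 := A.const.lam_r
  rw [h2] at h3
  linarith

theorem pos_mid (A : Arc f F p q r δ η c m lam x y τ) {t : ℝ} (ht : t ∈ Icc 0 τ)
    (hx : q + η ≤ x t) (hx' : x t ≤ r - δ) : 0 < lam * m - δ ∧ lam * m - δ ≤ y t := by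
  have h1 := A.neg_le_dev ht (by linarith [A.const.η_pos]) hx'
  have k4 : lam * m ≤ lam * (F q - F (x t)) :=
    mul_le_mul_of_nonneg_left (A.const.m_le (x t) ⟨hx, hx'⟩) A.const.lam_pos.le
  have h2 : 0 < δ * (lam * m - δ) := (mul_self_nonneg r).trans_lt A.const.lam_m'
  exact ⟨pos_of_mul_pos_right h2 A.data.δ_pos.le, by linarith⟩

end Arc

end JumpData

theorem not_bounded_of_le_deriv {g g' : ℝ → ℝ} (hg : ∀ t, HasDerivAt g (g' t) t) {k t₀ V : ℝ}
    (hk : 0 < k) (h : ∀ u, t₀ < u → k ≤ g' u) (hV : ∀ t, t₀ ≤ t → g t ≤ V) : False := by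
  have hV0 := hV t₀ le_rfl
  have h0 : t₀ ≤ t₀ + (V - g t₀ + 1) / k := by
    have : 0 ≤ (V - g t₀ + 1) / k := div_nonneg (by linarith) hk.le
    linarith
  have h1 := le_of_hasDerivAt_nonneg (fun t => (hg t).sub ((hasDerivAt_id t).const_mul k)) h0
    (fun u hu => by linarith [h u hu.1])
  have h2 := hV _ h0
  have h3 : k * ((V - g t₀ + 1) / k) = V - g t₀ + 1 := mul_div_cancel₀ _ hk.ne'
  simp only [Pi.sub_apply, id] at h1
  linarith

/-- The part of the limiting curve traced in the upper half plane: the slow branch over `[p, q]`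
followed by the jump over `[q, r]`. -/
def jumpCurve (F : ℝ → ℝ) (p q r lam : ℝ) : Set (ℝ × ℝ) :=
  (fun s => (s, (0 : ℝ))) '' Icc p q ∪ (fun s => (s, lam * (F q - F s))) '' Icc q r

namespace JumpData

variable {f F : ℝ → ℝ} {p q r δ η c m lam : ℝ} {x y : ℝ → ℝ}

theorem Arc.not_forall {τ : ℝ} (A : Arc f F p q r δ η c m lam x y τ)
    (hy : ∀ t, 0 < t → 0 < y t) : False := by
  have hA : ∀ τ, Arc f F p q r δ η c m lam x y τ := fun τ =>
    ⟨A.data, A.const, A.sol, A.start_ge, A.start_le, A.start, fun t ht => hy t ht.1⟩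
  have hδ := A.data.δ_pos
  have hη := A.const.η_lt
  have hlam := A.const.lam_pos
  have hup : ∀ t, 0 ≤ t → y t - lam * (F q - F (x t)) ≤ δ := fun t ht => by
    rcases le_total (x t) q with h | h
    · have h1 := (hA t).le_of_le ⟨ht, le_rfl⟩ h
      have h2 : 0 ≤ lam * (F q - F (x t)) := mul_nonneg hlam.le (sub_nonneg.2 (A.data.le_left h))
      linarith
    · exact (hA t).dev_le ⟨ht, le_rfl⟩ h
  obtain ⟨t₁, ht₁, hx₁⟩ : ∃ t, 0 ≤ t ∧ q + η ≤ x t := by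
    by_contra! hcon
    exact not_bounded_of_le_deriv A.hasDerivAt_dev (k := -(q + η)) (by linarith)
      (fun u hu => by linarith [hcon u hu.le]) hup
  obtain ⟨t₂, ht₂, hx₂⟩ : ∃ t, t₁ ≤ t ∧ r - δ ≤ x t := by
    by_contra! hcon
    have hmid : ∀ u, t₁ ≤ u → 0 < lam * m - δ ∧ lam * m - δ ≤ y u := fun u hu =>
      (hA u).pos_mid ⟨ht₁.trans hu, le_rfl⟩ (hx₁.trans ((hA u).mono ht₁ hu le_rfl)) (hcon u hu).le
    exact not_bounded_of_le_deriv A.sol.1 (hmid t₁ le_rfl).1 (fun u hu => (hmid u hu.le).2)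
      (fun u hu => (hcon u hu).le)
  have hx : ∀ u, t₂ ≤ u → r - δ ≤ x u := fun u hu =>
    hx₂.trans ((hA u).mono (ht₁.trans ht₂) hu le_rfl)
  refine not_bounded_of_le_deriv (fun t => (A.hasDerivAt_dev t).neg) (k := r - δ) (t₀ := t₂)
    (V := lam * (F q - F (r - δ))) (by linarith [A.data.δ_lt])
    (fun u hu => by linarith [hx u hu.le]) (fun u hu => ?_)
  have h1 := (hA u).nonneg ⟨ht₁.trans (ht₂.trans hu), le_rfl⟩
  have h2 : F (r - δ) ≤ F (x u) :=
    A.data.strictMonoOn_right.monotoneOn self_mem_Ici (hx u hu) (hx u hu)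
  have h3 : lam * F (r - δ) ≤ lam * F (x u) := mul_le_mul_of_nonneg_left h2 hlam.le
  simp only [Pi.neg_apply]
  linarith

theorem exists_endpoint (D : JumpData f F p q r δ) (hK : JumpConst f F p q r δ η c m lam)
    (h : IsLienardSol f lam x y) (h0 : p - δ ≤ x 0) (h0' : x 0 ≤ p + δ) (hy0 : y 0 = 0) :
    ∃ T, 0 < T ∧ (∀ t ∈ Ioo 0 T, 0 < y t) ∧ y T = 0 := by
  have hsign : ∀ᶠ t in 𝓝 (0 : ℝ), SignType.sign (y t) = SignType.sign (t - 0) := by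
    refine eventually_nhdsWithin_sign_eq_of_deriv_pos ?_ hy0
    rw [(h.2 0).deriv, hy0]
    linarith [D.p_lt, D.δ_pos, D.q_neg]
  obtain ⟨s, hs, hs'⟩ := Metric.eventually_nhds_iff.1 hsign
  have hpos : ∀ t, 0 < t → t < s → 0 < y t := fun t ht hts => by
    have h1 := hs' (y := t) (by rw [Real.dist_eq, sub_zero, abs_of_pos ht]; exact hts)
    rw [sub_zero, sign_pos ht] at h1
    exact sign_eq_one_iff.1 h1
  obtain ⟨t₁, ht₁, hyt₁⟩ : ∃ t, 0 < t ∧ y t ≤ 0 := by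
    by_contra! hcon
    exact Arc.not_forall (τ := 1) ⟨D, hK, h, h0, h0', hy0, fun t ht => hcon t ht.1⟩ hcon
  have hst₁ : s ≤ t₁ := by
    by_contra! hlt
    linarith [hpos t₁ ht₁ hlt]
  have hcomp : IsCompact (Icc (s / 2) t₁ ∩ {t | y t ≤ 0}) :=
    isCompact_Icc.inter_right (isClosed_le h.continuous_snd continuous_const)
  obtain ⟨T, ⟨hTm, hTy⟩, hTl⟩ := hcomp.exists_isLeast ⟨t₁, ⟨by linarith, le_rfl⟩, hyt₁⟩
  have hT0 : 0 < T := by linarith [hTm.1]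
  have hTpos : ∀ t ∈ Ioo 0 T, 0 < y t := fun t ht => by
    by_contra! hcon
    rcases lt_or_ge t s with h1 | h1
    · linarith [hpos t ht.1 h1]
    · exact ht.2.not_ge (hTl ⟨⟨by linarith, ht.2.le.trans hTm.2⟩, hcon⟩)
  exact ⟨T, hT0, hTpos, le_antisymm hTy
    (Arc.nonneg ⟨D, hK, h, h0, h0', hy0, hTpos⟩ (right_mem_Icc.2 hT0.le))⟩

namespace Arc

variable {T : ℝ}

theorem right_lt (A : Arc f F p q r δ η c m lam x y T) (hT : 0 < T) (hyT : y T = 0) :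
    r - δ < x T := by
  have hTm : T ∈ Icc 0 T := right_mem_Icc.2 hT.le
  by_contra! hle
  rcases le_or_gt (q + η) (x T) with h | h
  · have := A.pos_mid hTm h hle
    linarith
  have hsign : ∀ᶠ t in 𝓝 T, SignType.sign (y t) = SignType.sign (t - T) := by
    refine eventually_nhdsWithin_sign_eq_of_deriv_pos ?_ hyT
    rw [(A.sol.2 T).deriv, hyT]
    linarith [A.const.η_lt]
  obtain ⟨s, hs, hs'⟩ := Metric.eventually_nhds_iff.1 hsign
  set t := max (T / 2) (T - s / 2) with ht
  have h1 : T / 2 ≤ t := le_max_left _ _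
  have h2 : T - s / 2 ≤ t := le_max_right _ _
  have h3 : t < T := max_lt (by linarith) (by linarith)
  have h4 := hs' (y := t) (by rw [Real.dist_eq, abs_lt]; constructor <;> linarith)
  rw [sign_neg (sub_neg.2 h3), sign_eq_neg_one_iff] at h4
  linarith [A.nonneg (t := t) ⟨by linarith, h3.le⟩]

theorem exists_near_curve (A : Arc f F p q r δ η c m lam x y T) {t : ℝ} (ht : t ∈ Icc 0 T) :
    ∃ P ∈ jumpCurve F p q r lam, dist (x t, y t) P ≤ 2 * δ := by
  have hδ := A.data.δ_pos
  have hlam := A.const.lam_pos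
  have hx0 := A.mono le_rfl ht.1 ht.2
  have hy := A.nonneg ht
  rcases le_total (x t) q with h | h
  · refine ⟨(max (x t) p, 0), Or.inl ⟨_, ⟨le_max_right _ _, max_le h ?_⟩, rfl⟩, ?_⟩
    · linarith [A.data.p_lt]
    · have h1 := A.le_of_le ht h
      rw [Prod.dist_eq, max_le_iff, Real.dist_eq, Real.dist_eq, abs_le, abs_le]
      have h2 : max (x t) p ≤ x t + δ := max_le (by linarith) (by linarith [A.start_ge])
      have h3 := le_max_left (x t) p
      refine ⟨⟨?_, ?_⟩, ?_, ?_⟩ <;> dsimp only <;> linarith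
  have h1 := A.dev_le ht h
  rcases le_total (x t) (r - δ) with h' | h'
  · refine ⟨(x t, lam * (F q - F (x t))), Or.inr ⟨_, ⟨h, by linarith⟩, rfl⟩, ?_⟩
    have h2 := A.neg_le_dev ht h h'
    rw [Prod.dist_eq, max_le_iff, Real.dist_eq, Real.dist_eq, abs_le, abs_le]
    refine ⟨⟨?_, ?_⟩, ?_, ?_⟩ <;> dsimp only <;> linarith
  have hFc : Continuous F :=
    continuous_iff_continuousAt.2 fun s => (A.data.hasDerivAt s).continuousAt
  have h2 := A.lt_right ht
  have h3 : F (r - δ) ≤ F (x t) := A.data.strictMonoOn_right.monotoneOn self_mem_Ici h' h'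
  have h4 : lam * F (r - δ) ≤ lam * F (x t) := mul_le_mul_of_nonneg_left h3 hlam.le
  have h5 : F (r - δ) ≤ F q := A.data.eq_right ▸
    A.data.strictMonoOn_right.monotoneOn self_mem_Ici (mem_Ici.2 (by linarith)) (by linarith)
  have h6 : 0 ≤ lam * (F q - F (r - δ)) := mul_nonneg hlam.le (by linarith)
  obtain ⟨s, hs, hs'⟩ := intermediate_value_Icc' (a := r - δ) (b := r) (by linarith)
    (f := fun s => lam * (F q - F s)) (by fun_prop)
    (show min (y t) (lam * (F q - F (r - δ))) ∈ _ by
      rw [A.data.eq_right, sub_self, mul_zero]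
      exact ⟨le_min hy h6, min_le_right _ _⟩)
  dsimp only at hs'
  refine ⟨(s, lam * (F q - F s)), Or.inr ⟨s, ⟨?_, hs.2⟩, rfl⟩, ?_⟩
  · linarith [hs.1, A.data.δ_lt, A.data.q_neg]
  rw [hs', Prod.dist_eq, max_le_iff, Real.dist_eq, Real.dist_eq, abs_le, abs_le]
  have h7 := min_le_left (y t) (lam * (F q - F (r - δ)))
  have h8 : y t - δ ≤ min (y t) (lam * (F q - F (r - δ))) := le_min (by linarith) (by linarith)
  have hs1 := hs.1
  have hs2 := hs.2
  refine ⟨⟨?_, ?_⟩, ?_, ?_⟩ <;> dsimp only <;> linarith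

theorem exists_near_arc (A : Arc f F p q r δ η c m lam x y T) (hT : 0 < T) (hyT : y T = 0)
    {P : ℝ × ℝ} (hP : P ∈ jumpCurve F p q r lam) :
    ∃ t ∈ Icc 0 T, dist (x t, y t) P ≤ 2 * δ := by
  have hδ := A.data.δ_pos
  have hlam := A.const.lam_pos
  have hTm : T ∈ Icc 0 T := right_mem_Icc.2 hT.le
  have hxT := A.right_lt hT hyT
  have hq := A.data.q_neg
  have hr := A.data.δ_lt
  have hp := A.data.p_lt
  have hs0 := A.start_ge
  have hs1 := A.start_le
  have htime : ∀ s, x 0 ≤ s → s ≤ r - δ → ∃ t ∈ Icc 0 T, x t = s := fun s h h' => by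
    obtain ⟨t, h1, h2, h3⟩ := A.exists_time hTm h (h'.trans hxT.le)
    exact ⟨t, ⟨h1, h2⟩, h3⟩
  rcases hP with ⟨s, hs, rfl⟩ | ⟨s, hs, rfl⟩
  · have h1 := hs.1
    have h2 := hs.2
    have h3 : max s (x 0) ≤ q := max_le h2 (by linarith)
    obtain ⟨t, ht, hxt⟩ := htime (max s (x 0)) (le_max_right _ _) (by linarith)
    have h4 := A.le_of_le ht (hxt.trans_le h3)
    have h5 := A.nonneg ht
    have h6 : max s (x 0) ≤ s + δ := max_le (by linarith) (by linarith)
    have h7 := le_max_left s (x 0)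
    refine ⟨t, ht, ?_⟩
    rw [hxt, Prod.dist_eq, max_le_iff, Real.dist_eq, Real.dist_eq, abs_le, abs_le]
    refine ⟨⟨?_, ?_⟩, ?_, ?_⟩ <;> dsimp only <;> linarith
  have h1 := hs.1
  have h2 := hs.2
  rcases le_total s (r - δ) with h | h
  · obtain ⟨t, ht, hxt⟩ := htime s (by linarith) h
    have h3 := A.dev_le ht (hxt ▸ h1)
    have h4 := A.neg_le_dev ht (hxt ▸ h1) (hxt ▸ h)
    rw [hxt] at h3 h4
    refine ⟨t, ht, ?_⟩
    rw [hxt, Prod.dist_eq, max_le_iff, Real.dist_eq, Real.dist_eq, abs_le, abs_le]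
    refine ⟨⟨?_, ?_⟩, ?_, ?_⟩ <;> dsimp only <;> linarith
  obtain ⟨t₀, ht₀, hxt₀⟩ := htime (r - δ) (by linarith) le_rfl
  have h3 := A.neg_le_dev ht₀ (by linarith) hxt₀.le
  rw [hxt₀] at h3
  have h4 : F (r - δ) ≤ F s := A.data.strictMonoOn_right.monotoneOn self_mem_Ici h h
  have h5 : lam * F (r - δ) ≤ lam * F s := mul_le_mul_of_nonneg_left h4 hlam.le
  have h6 : 0 ≤ lam * (F q - F s) := mul_nonneg hlam.le (sub_nonneg.2 (A.data.le_mid h1 h2))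
  have h7 := A.nonneg ht₀
  obtain ⟨t, ht, hyt⟩ := intermediate_value_Icc' ht₀.2 A.sol.continuous_snd.continuousOn
    (show min (lam * (F q - F s)) (y t₀) ∈ _ by
      rw [hyT]
      exact ⟨le_min h6 h7, min_le_right _ _⟩)
  have ht' : t ∈ Icc 0 T := ⟨ht₀.1.trans ht.1, ht.2⟩
  have h8 := A.lt_right ht'
  have h9 := A.mono ht₀.1 ht.1 ht.2
  have h10 := min_le_left (lam * (F q - F s)) (y t₀)
  have h11 : lam * (F q - F s) - δ ≤ min (lam * (F q - F s)) (y t₀) :=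
    le_min (by linarith) (by linarith)
  refine ⟨t, ht', ?_⟩
  rw [hyt, Prod.dist_eq, max_le_iff, Real.dist_eq, Real.dist_eq, abs_le, abs_le]
  refine ⟨⟨?_, ?_⟩, ?_, ?_⟩ <;> dsimp only <;> linarith

end Arc

end JumpData

theorem exists_fixedPoint_of_monotoneOn {Q : ℝ → ℝ} {a b : ℝ} (hab : a ≤ b)
    (hQ : MapsTo Q (Icc a b) (Icc a b)) (hm : MonotoneOn Q (Icc a b)) :
    ∃ s ∈ Icc a b, Q s = s := by
  set S := {s | s ∈ Icc a b ∧ s ≤ Q s} with hS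
  have hne : a ∈ S := ⟨left_mem_Icc.2 hab, (hQ (left_mem_Icc.2 hab)).1⟩
  have hbdd : BddAbove S := ⟨b, fun s hs => hs.1.2⟩
  have hmem : sSup S ∈ Icc a b := ⟨le_csSup hbdd hne, csSup_le ⟨a, hne⟩ fun s hs => hs.1.2⟩
  have hle : sSup S ≤ Q (sSup S) :=
    csSup_le ⟨a, hne⟩ fun s hs => hs.2.trans (hm hs.1 hmem (le_csSup hbdd hs))
  exact ⟨_, hmem, le_antisymm (le_csSup hbdd ⟨hQ hmem, hm hmem (hQ hmem) hle⟩) hle⟩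

namespace JumpData

variable {f F : ℝ → ℝ} {p q q' r δ : ℝ}

theorem exists_arcs (D : JumpData f F p q r δ) {C : ℝ≥0} (hC : ∀ s, ‖f s‖₊ ≤ C) :
    ∃ η c m lam₁, 0 < lam₁ ∧ ∀ lam, lam₁ < lam → ∀ a ∈ Icc (p - δ) (p + δ),
      ∃ x y T, Arc f F p q r δ η c m lam x y T ∧ x 0 = a ∧ 0 < T ∧ y T = 0 := by
  obtain ⟨η, c, m, lam₁, h0, h⟩ := D.exists_const
  refine ⟨η, c, m, lam₁, h0, fun lam hlam a ha => ?_⟩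
  obtain ⟨x, y, hs, hx, hy⟩ := exists_isLienardSol D.hasDerivAt D.continuous hC lam a
  have h1 : p - δ ≤ x 0 := hx.symm ▸ ha.1
  have h2 : x 0 ≤ p + δ := hx.symm ▸ ha.2
  obtain ⟨T, hT, hp, hyT⟩ := D.exists_endpoint (h lam hlam) hs h1 h2 hy
  exact ⟨x, y, T, ⟨D, h lam hlam, hs, h1, h2, hy, hp⟩, hx, hT, hyT⟩

theorem Arc.endpoint_le {η c m lam : ℝ} {C : ℝ≥0} (hC : ∀ s, ‖f s‖₊ ≤ C)
    {x y x' y' : ℝ → ℝ} {T T' : ℝ}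
    (A : Arc f F p q r δ η c m lam x y T) (A' : Arc f F p q r δ η c m lam x' y' T')
    (hT : 0 < T) (hT' : 0 < T') (hyT : y T = 0) (h0 : x 0 < x' 0) : x' T' ≤ x T :=
  A.sol.endpoint_le A.data.hasDerivAt hC A'.sol hT hT' A.pos A'.pos A.start hyT A'.start h0
    (by linarith [A.right_lt hT hyT, A'.start_le, A.data.p_lt, A.data.q_neg, A.data.δ_lt,
      A.data.δ_pos])

/-- Relaxation oscillation for a Liénard system with bounded damping. -/
theorem exists_periodic (D : JumpData f F p q r δ)
    (D' : JumpData (fun s => f (-s)) (fun s => -F (-s)) (-r) (-q') (-p) δ)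
    {C : ℝ≥0} (hC : ∀ s, ‖f s‖₊ ≤ C) :
    ∃ lam₁ > 0, ∀ lam, lam₁ < lam → ∃ x y : ℝ → ℝ, IsLienardSol f lam x y ∧
      (∃ T, 0 < T ∧ ∀ t, x (t + T) = x t ∧ y (t + T) = y t) ∧
      (∃ t₁ t₂, x t₁ < x t₂) ∧ (∀ t, x t ∈ Icc (p - δ) (r + δ)) ∧
      (∀ t, ∃ P ∈ jumpCurve F p q r lam ∪
        Neg.neg '' jumpCurve (fun s => -F (-s)) (-r) (-q') (-p) lam,
        dist (x t, y t) P ≤ 2 * δ) ∧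
      ∀ P ∈ jumpCurve F p q r lam ∪
        Neg.neg '' jumpCurve (fun s => -F (-s)) (-r) (-q') (-p) lam,
        ∃ t, dist (x t, y t) P ≤ 2 * δ := by
  have hC' : ∀ s, ‖(fun s => f (-s)) s‖₊ ≤ C := fun s => hC (-s)
  have hδ := D.δ_pos
  obtain ⟨η, c, m, l, hl, hA⟩ := D.exists_arcs hC
  obtain ⟨η', c', m', l', hl', hA'⟩ := D'.exists_arcs hC'
  refine ⟨max l l', lt_max_of_lt_left hl, fun lam hlam => ?_⟩
  replace hA := hA lam ((le_max_left _ _).trans_lt hlam)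
  replace hA' := hA' lam ((le_max_right _ _).trans_lt hlam)
  choose! X Y T A hX0 hT hYT using hA
  choose! X' Y' T' A' hX0' hT' hYT' using hA'
  have hb : ∀ a ∈ Icc (p - δ) (p + δ), -X a (T a) ∈ Icc (-r - δ) (-r + δ) := fun a ha => by
    have h1 := (A a ha).right_lt (hT a ha) (hYT a ha)
    have h2 := (A a ha).lt_right (right_mem_Icc.2 (hT a ha).le)
    constructor <;> linarith
  have hb' : ∀ a ∈ Icc (-r - δ) (-r + δ), -X' a (T' a) ∈ Icc (p - δ) (p + δ) := fun a ha => by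
    have h1 := (A' a ha).right_lt (hT' a ha) (hYT' a ha)
    have h2 := (A' a ha).lt_right (right_mem_Icc.2 (hT' a ha).le)
    constructor <;> linarith
  obtain ⟨a, ha, hfix⟩ := exists_fixedPoint_of_monotoneOn
    (Q := fun a => -X' (-X a (T a)) (T' (-X a (T a)))) (a := p - δ) (b := p + δ) (by linarith)
    (fun a ha => hb' _ (hb a ha)) (by
      intro a ha b hb'' hab
      rcases hab.eq_or_lt with rfl | hlt
      · exact le_rfl
      have h1 : X b (T b) ≤ X a (T a) := (A a ha).endpoint_le hC (A b hb'') (hT a ha) (hT b hb'')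
        (hYT a ha) (by rwa [hX0 a ha, hX0 b hb''])
      rcases h1.eq_or_lt with h2 | h2
      · simp only [h2, le_refl]
      · have k1 := hb a ha
        have k2 := hb b hb''
        exact neg_le_neg ((A' _ k1).endpoint_le hC' (A' _ k2) (hT' _ k1) (hT' _ k2) (hYT' _ k1)
          (by rw [hX0' _ k1, hX0' _ k2]; exact neg_lt_neg h2)))
  have k := hb a ha
  replace A := A a ha
  replace hX0 := hX0 a ha
  replace hT := hT a ha
  replace hYT := hYT a ha
  have hr := A.right_lt hT hYT
  have hr2 := A.lt_right (right_mem_Icc.2 hT.le)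
  generalize X a = x at *
  generalize Y a = y at *
  generalize T a = T at *
  replace A' := A' _ k
  replace hX0' := hX0' _ k
  replace hT' := hT' _ k
  replace hYT' := hYT' _ k
  have hr' := A'.right_lt hT' hYT'
  generalize X' (-x T) = x' at *
  generalize Y' (-x T) = y' at *
  generalize T' (-x T) = T' at *
  have hneg : IsLienardSol f lam (fun t => -x' t) (fun t => -y' t) := by
    simpa only [neg_neg] using A'.sol.neg
  have hglue : ∀ s, x (s + T) = -x' s ∧ y (s + T) = -y' s := fun s => by
    have := A.sol.unique D.hasDerivAt hC hneg (t₁ := T) (t₂ := 0) (by rw [hX0', neg_neg])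
      (by rw [hYT, A'.start, neg_zero]) s
    simpa only [add_zero] using this
  have hper : ∀ t, x (t + (T' + T)) = x t ∧ y (t + (T' + T)) = y t := fun t => by
    obtain ⟨h1, h2⟩ := hglue T'
    have := A.sol.unique D.hasDerivAt hC A.sol (t₁ := T' + T) (t₂ := 0)
      (by rw [h1, hfix, hX0]) (by rw [h2, hYT', A.start, neg_zero]) t
    simpa only [add_zero] using this
  have hcases : ∀ t, (∃ s ∈ Icc 0 T, x t = x s ∧ y t = y s) ∨
      ∃ s ∈ Icc 0 T', x t = -x' s ∧ y t = -y' s := fun t => by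
    have hp : Function.Periodic (fun t => (x t, y t)) (T' + T) := fun t =>
      Prod.ext (hper t).1 (hper t).2
    obtain ⟨s, hs, hst⟩ := hp.exists_mem_Ico₀ (by linarith) t
    simp only [Prod.mk.injEq] at hst
    rcases le_total s T with h | h
    · exact Or.inl ⟨s, ⟨hs.1, h⟩, hst⟩
    · refine Or.inr ⟨s - T, ⟨by linarith, by linarith [hs.2]⟩, ?_⟩
      rw [hst.1, hst.2]
      have := hglue (s - T)
      rwa [sub_add_cancel] at this
  refine ⟨x, y, A.sol, ⟨T' + T, by linarith, hper⟩, ⟨0, T, ?_⟩, fun t => ?_, fun t => ?_, ?_⟩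
  · linarith [D.q_neg, D.p_lt, D.δ_lt, A.start_le]
  · rcases hcases t with ⟨s, hs, h1, -⟩ | ⟨s, hs, h1, -⟩
    · rw [h1]
      exact ⟨A.start_ge.trans (A.mono le_rfl hs.1 hs.2), (A.lt_right hs).le⟩
    · have h2 := A'.mono le_rfl hs.1 hs.2
      have h3 := A'.lt_right hs
      have h4 := A'.start_ge
      rw [h1]
      constructor <;> linarith
  · rcases hcases t with ⟨s, hs, h1, h2⟩ | ⟨s, hs, h1, h2⟩
    · obtain ⟨P, hP, hd⟩ := A.exists_near_curve hs
      exact ⟨P, Or.inl hP, by rwa [h1, h2]⟩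
    · obtain ⟨P, hP, hd⟩ := A'.exists_near_curve hs
      refine ⟨-P, Or.inr ⟨P, hP, rfl⟩, ?_⟩
      rwa [h1, h2, ← Prod.neg_mk, dist_neg_neg]
  · rintro P (hP | ⟨P, hP, rfl⟩)
    · obtain ⟨t, -, hd⟩ := A.exists_near_arc hT hYT hP
      exact ⟨t, hd⟩
    · obtain ⟨t, -, hd⟩ := A'.exists_near_arc hT' hYT' hP
      refine ⟨t + T, ?_⟩
      rwa [(hglue t).1, (hglue t).2, ← Prod.neg_mk, dist_neg_neg]

theorem of_signs {xM xm x₁ x₂ : ℝ} (hF : ∀ s, HasDerivAt F (f s) s) (hf : Continuous f)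
    (hxM : xM < 0) (hxm : 0 < xm) (hl : ∀ s, s < xM → 0 < f s)
    (hm : ∀ s, xM < s → s < xm → f s < 0) (hr : ∀ s, xm < s → 0 < f s) (hδ : 0 < δ)
    (h₁ : x₁ + 2 * δ < xM) (h₂ : xm + 2 * δ < x₂) (hx₂ : F x₂ = F xM) :
    JumpData f F x₁ xM x₂ δ where
  hasDerivAt := hF
  continuous := hf
  q_neg := hxM
  δ_pos := hδ
  p_lt := h₁
  δ_lt := by linarith
  pos_left := hl
  lt_mid := fun s hs hs' => by
    have hFc : Continuous F := continuous_iff_continuousAt.2 fun s => (hF s).continuousAt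
    rcases le_or_gt s xm with h | h
    · refine strictAntiOn_of_deriv_neg (convex_Icc xM xm) hFc.continuousOn (fun u hu => ?_)
        (left_mem_Icc.2 (by linarith)) ⟨hs.le, h⟩ hs
      rw [interior_Icc] at hu
      rw [(hF u).deriv]
      exact hm u hu.1 hu.2
    · rw [← hx₂]
      refine strictMonoOn_of_deriv_pos (convex_Ici xm) hFc.continuousOn (fun u hu => ?_)
        h.le (h.trans hs').le hs'
      rw [interior_Ici] at hu
      rw [(hF u).deriv]
      exact hr u hu
  eq_right := hx₂
  pos_right := fun s hs => hr s (by linarith)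

theorem of_signs_neg {xM xm x₁ x₂ : ℝ} (hF : ∀ s, HasDerivAt F (f s) s) (hf : Continuous f)
    (hxM : xM < 0) (hxm : 0 < xm) (hl : ∀ s, s < xM → 0 < f s)
    (hm : ∀ s, xM < s → s < xm → f s < 0) (hr : ∀ s, xm < s → 0 < f s) (hδ : 0 < δ)
    (h₁ : x₁ + 2 * δ < xM) (h₂ : xm + 2 * δ < x₂) (hx₁ : F x₁ = F xm) :
    JumpData (fun s => f (-s)) (fun s => -F (-s)) (-x₂) (-xm) (-x₁) δ :=
  of_signs (xm := -xM)
    (fun s => (((hF (-s)).comp s (hasDerivAt_neg s)).neg).congr_deriv (by ring))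
    (hf.comp continuous_neg) (by linarith) (by linarith) (fun s hs => hr _ (by linarith))
    (fun s hs hs' => hm _ (by linarith) (by linarith)) (fun s hs => hl _ (by linarith)) hδ
    (by linarith) (by linarith) (by simp only [neg_neg, hx₁])

end JumpData

theorem pos_of_ne_zero_of_preconnected {f : ℝ → ℝ} {S : Set ℝ} (hS : IsPreconnected S)
    (hf : Continuous f) (h0 : ∀ s ∈ S, f s ≠ 0) {u : ℝ} (hu : u ∈ S) (hpos : 0 < f u) :
    ∀ s ∈ S, 0 < f s := by
  intro s hs
  by_contra! h
  obtain ⟨v, hv, hv0⟩ := hS.intermediate_value hs hu hf.continuousOn ⟨h, hpos.le⟩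
  exact h0 v hv hv0

theorem signs_of_zeros {f : ℝ → ℝ} {xM xm : ℝ} (hf : Continuous f) (hlt : xM < xm)
    (hfxM : f xM = 0) (hfxm : f xm = 0) (hzeros : ∀ x, f x = 0 → x = xM ∨ x = xm)
    (hdM : deriv f xM < 0) (hdm : 0 < deriv f xm) :
    (∀ s, s < xM → 0 < f s) ∧ (∀ s, xM < s → s < xm → f s < 0) ∧ ∀ s, xm < s → 0 < f s := by
  have hM := eventually_nhdsWithin_sign_eq_of_deriv_neg hdM hfxM
  have hm := eventually_nhdsWithin_sign_eq_of_deriv_pos hdm hfxm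
  obtain ⟨a, ha, ha'⟩ := ((hM.filter_mono nhdsWithin_le_nhds).and
    (self_mem_nhdsWithin : Iio xM ∈ 𝓝[<] xM)).exists
  obtain ⟨b, hb, hb'⟩ := ((hM.filter_mono nhdsWithin_le_nhds).and
    (Ioo_mem_nhdsGT hlt)).exists
  obtain ⟨c, hc, hc'⟩ := ((hm.filter_mono nhdsWithin_le_nhds).and
    (self_mem_nhdsWithin : Ioi xm ∈ 𝓝[>] xm)).exists
  rw [sign_pos (sub_pos.2 ha'), sign_eq_one_iff] at ha
  rw [sign_neg (sub_neg.2 hb'.1), sign_eq_neg_one_iff] at hb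
  rw [sign_pos (sub_pos.2 hc'), sign_eq_one_iff] at hc
  refine ⟨pos_of_ne_zero_of_preconnected isPreconnected_Iio hf (fun s hs h => ?_) ha' ha,
    fun s hs hs' => neg_pos.1 (pos_of_ne_zero_of_preconnected (f := fun s => -f s)
      isPreconnected_Ioo hf.neg (fun s hs h => ?_) hb' (neg_pos.2 hb) s ⟨hs, hs'⟩),
    pos_of_ne_zero_of_preconnected isPreconnected_Ioi hf (fun s hs h => ?_) hc' hc⟩
  · have h1 : s < xM := hs
    rcases hzeros s h with rfl | rfl <;> linarith
  · rcases hzeros s (neg_eq_zero.1 h) with rfl | rfl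
    · exact lt_irrefl _ hs.1
    · exact lt_irrefl _ hs.2
  · have h1 : xm < s := hs
    rcases hzeros s h with rfl | rfl <;> linarith

theorem image_eq_jumpCurve_union {F G : ℝ → ℝ} {xM xm x₁ x₂ : ℝ} (lam : ℝ) (h₁ : x₁ ≤ xM)
    (h : xM ≤ xm) (h₂ : xm ≤ x₂) (hG : ∀ s ∈ Icc x₁ x₂, G s = F s) :
    (fun q : ℝ × ℝ => (q.1, lam * (q.2 - F q.1))) '' ((fun t => (t, F xM)) '' Icc xM x₂ ∪
        (fun t => (t, F t)) '' Icc xm x₂ ∪ (fun t => (t, F xm)) '' Icc x₁ xm ∪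
        (fun t => (t, F t)) '' Icc x₁ xM) =
      jumpCurve G x₁ xM x₂ lam ∪
        Neg.neg '' jumpCurve (fun s => -G (-s)) (-x₂) (-xm) (-x₁) lam := by
  have hM := hG xM ⟨h₁, h.trans h₂⟩
  have hm := hG xm ⟨h₁.trans h, h₂⟩
  have e₁ : (fun q : ℝ × ℝ => (q.1, lam * (q.2 - F q.1))) '' ((fun t => (t, F xM)) '' Icc xM x₂) =
      (fun s => (s, lam * (G xM - G s))) '' Icc xM x₂ := by
    rw [image_image]
    refine image_congr fun s hs => ?_
    simp only [hM, hG s ⟨h₁.trans hs.1, hs.2⟩]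
  have e₂ : (fun q : ℝ × ℝ => (q.1, lam * (q.2 - F q.1))) '' ((fun t => (t, F t)) '' Icc xm x₂) =
      Neg.neg '' ((fun s => (s, (0 : ℝ))) '' Icc (-x₂) (-xm)) := by
    rw [← image_neg_Icc]
    simp only [image_image, sub_self, mul_zero, Prod.neg_mk, neg_neg, neg_zero]
  have e₃ : (fun q : ℝ × ℝ => (q.1, lam * (q.2 - F q.1))) '' ((fun t => (t, F xm)) '' Icc x₁ xm) =
      Neg.neg '' ((fun s => (s, lam * (-G (- -xm) - -G (-s)))) '' Icc (-xm) (-x₁)) := by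
    rw [← image_neg_Icc]
    simp only [image_image, Prod.neg_mk, neg_neg]
    refine image_congr fun s hs => ?_
    rw [hm, hG s ⟨hs.1, hs.2.trans h₂⟩]
    exact Prod.ext rfl (by ring)
  have e₄ : (fun q : ℝ × ℝ => (q.1, lam * (q.2 - F q.1))) '' ((fun t => (t, F t)) '' Icc x₁ xM) =
      (fun s => (s, (0 : ℝ))) '' Icc x₁ xM := by
    simp only [image_image, sub_self, mul_zero]
  simp only [jumpCurve, image_union (f := fun q : ℝ × ℝ => (q.1, lam * (q.2 - F q.1))), e₁, e₂, e₃,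
    e₄, image_union (f := (Neg.neg : ℝ × ℝ → ℝ × ℝ))]
  ext P
  simp only [mem_union]
  tauto

/-- Replacing `f` outside `[a, b]` by its boundary values makes it bounded. -/
theorem exists_nnnorm_clamp_le {f : ℝ → ℝ} (hf : Continuous f) {a b : ℝ} (hab : a ≤ b) :
    ∃ C : ℝ≥0, ∀ s, ‖f (max a (min b s))‖₊ ≤ C := by
  obtain ⟨C, hC⟩ := (isCompact_Icc (a := a) (b := b)).exists_bound_of_continuousOn
    hf.continuousOn
  refine ⟨C.toNNReal, fun s => NNReal.coe_le_coe.1 ?_⟩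
  exact (hC _ ⟨le_max_left _ _, max_le hab (min_le_left _ _)⟩).trans (Real.le_coe_toNNReal C)

theorem exists_periodic_near_jumpCurve {f F : ℝ → ℝ} {xM xm x₁ x₂ : ℝ} (hf : Continuous f)
    (hxM : xM < 0) (hxm : 0 < xm) (hl : ∀ s, s < xM → 0 < f s)
    (hm : ∀ s, xM < s → s < xm → f s < 0) (hr : ∀ s, xm < s → 0 < f s)
    (hF : ∀ x, F x = ∫ s in (0 : ℝ)..x, f s) (hx₁ : x₁ < xM) (hx₂ : xm < x₂)
    (hFx₁ : F x₁ = F xm) (hFx₂ : F x₂ = F xM) {ε : ℝ} (hε : 0 < ε) :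
    ∃ lam₁ > (0 : ℝ), ∀ lam : ℝ, lam₁ < lam → ∃ x y : ℝ → ℝ, IsPeriodicSol f lam x y ∧
      Metric.hausdorffDist (range fun t => (x t, y t))
        ((fun q : ℝ × ℝ => (q.1, lam * (q.2 - F q.1))) '' ((fun t => (t, F xM)) '' Icc xM x₂ ∪
          (fun t => (t, F t)) '' Icc xm x₂ ∪ (fun t => (t, F xm)) '' Icc x₁ xm ∪
          (fun t => (t, F t)) '' Icc x₁ xM)) < ε := by
  obtain ⟨δ, hδ, hδ'⟩ : ∃ δ > 0, δ < min (min 1 (ε / 2)) (min ((xM - x₁) / 2) ((x₂ - xm) / 2)) :=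
    exists_between (lt_min (lt_min one_pos (by linarith)) (lt_min (by linarith) (by linarith)))
  simp only [lt_min_iff] at hδ'
  obtain ⟨⟨hδ1, hδε⟩, hδM, hδm⟩ := hδ'
  set g : ℝ → ℝ := fun s => f (max (x₁ - 1) (min (x₂ + 1) s)) with hg
  have hgc : Continuous g := by fun_prop
  have hgf : ∀ s ∈ Icc (x₁ - 1) (x₂ + 1), g s = f s := fun s hs => by
    simp only [hg, min_eq_right hs.2, max_eq_right hs.1]
  have hgl : ∀ s, s < xM → 0 < g s := fun s hs =>
    hl _ (max_lt (by linarith) (min_lt_of_right_lt hs))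
  have hgm : ∀ s, xM < s → s < xm → g s < 0 := fun s hs hs' => by
    rw [hgf s ⟨by linarith, by linarith⟩]
    exact hm s hs hs'
  have hgr : ∀ s, xm < s → 0 < g s := fun s hs =>
    hr _ (lt_max_of_lt_right (lt_min (by linarith) hs))
  set G : ℝ → ℝ := fun x => ∫ s in (0 : ℝ)..x, g s with hG
  have hGd : ∀ s, HasDerivAt G (g s) s := fun s => (hgc.integral_hasStrictDerivAt 0 s).hasDerivAt
  have hGF : ∀ s ∈ Icc x₁ x₂, G s = F s := fun s hs => by
    rw [hF, hG]
    refine intervalIntegral.integral_congr fun u hu => hgf u ?_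
    exact uIcc_subset_Icc ⟨by linarith, by linarith⟩ ⟨by linarith [hs.1], by linarith [hs.2]⟩ hu
  have hG₁ : G x₁ = G xm := by
    rw [hGF _ ⟨le_rfl, by linarith⟩, hGF _ ⟨by linarith, by linarith⟩, hFx₁]
  have hG₂ : G x₂ = G xM := by
    rw [hGF _ ⟨by linarith, le_rfl⟩, hGF _ ⟨by linarith, by linarith⟩, hFx₂]
  obtain ⟨C, hC⟩ := exists_nnnorm_clamp_le hf (show x₁ - 1 ≤ x₂ + 1 by linarith)
  obtain ⟨lam₁, hlam₁, h⟩ := (JumpData.of_signs (x₁ := x₁) hGd hgc hxM hxm hgl hgm hgr hδ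
    (by linarith) (by linarith) hG₂).exists_periodic
    (JumpData.of_signs_neg (x₂ := x₂) hGd hgc hxM hxm hgl hgm hgr hδ
    (by linarith) (by linarith) hG₁) hC
  refine ⟨lam₁, hlam₁, fun lam hlam => ?_⟩
  obtain ⟨x, y, hsol, hper, ⟨t₁, t₂, hlt⟩, hx, hnear, hnear'⟩ := h lam hlam
  refine ⟨x, y, ⟨hper, hsol.1, fun t => ?_, t₁, t₂, fun h => ?_⟩, ?_⟩
  · rw [← hgf (x t) ⟨by linarith [(hx t).1], by linarith [(hx t).2]⟩]
    exact hsol.2 t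
  · exact hlt.ne (congrArg Prod.fst h)
  · rw [image_eq_jumpCurve_union lam hx₁.le (by linarith) hx₂.le hGF]
    refine (Metric.hausdorffDist_le_of_mem_dist (r := 2 * δ) (by linarith) ?_ ?_).trans_lt
      (by linarith)
    · rintro _ ⟨t, rfl⟩
      exact hnear t
    · intro P hP
      obtain ⟨t, ht⟩ := hnear' P hP
      exact ⟨_, ⟨t, rfl⟩, by rwa [dist_comm]⟩

end

theorem limit_cycle_large_lambda (f : ℝ → ℝ) (xM xm : ℝ)
    (hf : ContDiff ℝ 2 f)
    (hxM : xM < 0) (hxm : 0 < xm)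
    (hfxM : f xM = 0) (hfxm : f xm = 0)
    (hzeros : ∀ x, f x = 0 → x = xM ∨ x = xm)
    (hdM : deriv f xM < 0) (hdm : 0 < deriv f xm)
    (F : ℝ → ℝ) (hF : ∀ x, F x = ∫ s in (0:ℝ)..x, f s)
    (x₁ x₂ : ℝ) (hx₁ : x₁ < xM) (hx₂ : xm < x₂)
    (hFx₁ : F x₁ = F xm) (hFx₂ : F x₂ = F xM)
    (Γ₀ : Set (ℝ × ℝ))
    (hΓ₀ : Γ₀ = (fun t => (t, F xM)) '' Set.Icc xM x₂ ∪
        (fun t => (t, F t)) '' Set.Icc xm x₂ ∪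
        (fun t => (t, F xm)) '' Set.Icc x₁ xm ∪
        (fun t => (t, F t)) '' Set.Icc x₁ xM) :
    ∀ ε > (0:ℝ), ∃ lam₁ > (0:ℝ), ∀ lam : ℝ, lam₁ < lam →
      ∃ x y : ℝ → ℝ, IsPeriodicSol f lam x y ∧
        Metric.hausdorffDist (Set.range (fun t => (x t, y t)))
          ((fun q : ℝ × ℝ => (q.1, lam * (q.2 - F q.1))) '' Γ₀) < ε := by
  obtain ⟨hl, hm, hr⟩ := signs_of_zeros hf.continuous (hxM.trans hxm) hfxM hfxm hzeros hdM hdm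
  intro ε hε
  rw [hΓ₀]
  exact exists_periodic_near_jumpCurve hf.continuous hxM hxm hl hm hr hF hx₁ hx₂ hFx₁ hFx₂ hε
end
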